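/- arXiv:1712.02669 — 2 statements merged into one kernel-verified Lean document; each statement's English description precedes it below -/
import Mathlib

section
/- If V_{κ+2} is a natural model of Marshall's theory B_2 (i.e., (V_{κ+2}, ∈) ⊨ B_2), then κ is a limit of a 1-extendible chain, that is, there is a set S ⊆ κ cofinal in κ such that whenever α ∈ S, α < β, and β ∈ S ∪ {κ}, then α is 1-extendible to β. -/
universe u

/-- Formulas of the first-order language of set theory (one binary relation `∈`),
with named variables. -/
inductive FOF : Type
  | eq (i j : ℕ)
  | mem (i j : ℕ)
  | not (φ : FOF)
  | and (φ ψ : FOF)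
  | or (φ ψ : FOF)
  | all (i : ℕ) (φ : FOF)
  | ex (i : ℕ) (φ : FOF)

/-- Satisfaction of a first-order formula in the structure with universe the elements of
`M` satisfying `D`, with membership interpreted by `E` (so `FOF.Eval E D φ ρ` is the
relativization of `φ` to `D`). -/
def FOF.Eval {M : Type*} (E : M → M → Prop) (D : M → Prop) : FOF → (ℕ → M) → Prop
  | .eq i j, ρ => ρ i = ρ j
  | .mem i j, ρ => E (ρ i) (ρ j)
  | .not φ, ρ => ¬ FOF.Eval E D φ ρ
  | .and φ ψ, ρ => FOF.Eval E D φ ρ ∧ FOF.Eval E D ψ ρ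
  | .or φ ψ, ρ => FOF.Eval E D φ ρ ∨ FOF.Eval E D ψ ρ
  | .all i φ, ρ => ∀ x, D x → FOF.Eval E D φ (Function.update ρ i x)
  | .ex i φ, ρ => ∃ x, D x ∧ FOF.Eval E D φ (Function.update ρ i x)

/-- The free variables of a first-order formula. -/
def FOF.free : FOF → Set ℕ
  | .eq i j => {i, j}
  | .mem i j => {i, j}
  | .not φ => φ.free
  | .and φ ψ => φ.free ∪ ψ.free
  | .or φ ψ => φ.free ∪ ψ.free
  | .all i φ => φ.free \ {i}
  | .ex i φ => φ.free \ {i}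
section MarshallB2

variable {M : Type u} (E : M → M → Prop)

/-- In Marshall's theory `B₂` the objects of the domain of discourse are 2-classes; an
object is a class iff it is a member of some 2-class. -/
def IsClassB2 (x : M) : Prop := ∃ c, E x c

/-- An object is a set iff it is a member of some class. -/
def IsSetB2 (x : M) : Prop := ∃ c, IsClassB2 E c ∧ E x c

/-- `STC(v)`: `v` is transitive and every sub-2-class of an element of `v` is an element
of `v`. -/
def STCI (v : M) : Prop :=
  (∀ y, E y v → ∀ z, E z y → E z v) ∧
  (∀ y, E y v → ∀ x, (∀ z, E z x → E z y) → E x v)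

/-- `z` is empty. -/
def EmptyB2 (z : M) : Prop := ∀ w, ¬ E w z

/-- `p` is the Kuratowski pair `⟨a, b⟩`. -/
def KpairB2 (p a b : M) : Prop :=
  ∀ z, E z p ↔ ((∀ w, E w z ↔ w = a) ∨ (∀ w, E w z ↔ (w = a ∨ w = b)))

/-- `p` is the ordered pair of classes `[x, y] = x × {0} ∪ y × {1}`. -/
def CPairI (p x y : M) : Prop :=
  ∀ z, E z p ↔
    ((∃ a t, E a x ∧ EmptyB2 E t ∧ KpairB2 E z a t) ∨
     (∃ b t, E b y ∧ (∀ w, E w t ↔ EmptyB2 E w) ∧ KpairB2 E z b t))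

/-- `A(u)`: `u ∩ V₀` is a set, `STC(u ∩ V₀)` holds, and `u` is closed under ordered pairs
`[x, y]`.  (`w` denotes `u ∩ V₀`.) -/
def AuI (u : M) : Prop :=
  (∃ w, (∀ z, E z w ↔ (E z u ∧ IsSetB2 E z)) ∧ IsSetB2 E w ∧ STCI E w) ∧
  (∀ x y, E x u → E y u → ∃ p, E p u ∧ CPairI E p x y)

/-- `b = A^u`: `b` is `A ∩ u` if `A` is a class, and `{x ∩ u : x ∈ A ∩ u}` otherwise. -/
def RelParamB2 (u A b : M) : Prop :=
  (IsClassB2 E A ∧ ∀ z, E z b ↔ (E z A ∧ E z u)) ∨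
  (¬ IsClassB2 E A ∧
    ∀ z, E z b ↔ ∃ x, E x A ∧ E x u ∧ (∀ w, E w z ↔ (E w x ∧ E w u)))

/-- `(M, E)` is a model of Marshall's theory `B₂`: 2-class specification, extensionality,
the reflection schema `φ(A) → ∃u (A(u) ∧ φ^{PP(u ∩ V₀)}(A^u))`, foundation, and choice
for sets. -/
def SatB2 : Prop :=
  -- (A1) 2-class specification
  (∀ (φ : FOF) (ρ : ℕ → M), ∃ A : M, ∀ x,
      E x A ↔ (FOF.Eval E (fun _ => True) φ (Function.update ρ 0 x) ∧ IsClassB2 E x)) ∧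
  -- (A2) extensionality
  (∀ A B : M, (∀ x, E x A ↔ E x B) → A = B) ∧
  -- (A3) reflection: φ(A) → ∃u (A(u) ∧ φ^{PP(u ∩ V₀)}(A^u)), for φ with one free variable
  (∀ φ : FOF, φ.free ⊆ {0} → ∀ ρ : ℕ → M,
      FOF.Eval E (fun _ => True) φ ρ →
      ∃ u w b : M, (∀ z, E z w ↔ (E z u ∧ IsSetB2 E z)) ∧ IsSetB2 E w ∧ STCI E w ∧
        (∀ x y, E x u → E y u → ∃ p, E p u ∧ CPairI E p x y) ∧
        RelParamB2 E u (ρ 0) b ∧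
        FOF.Eval E (fun x => ∀ y, E y x → ∀ z, E z y → E z w) φ (Function.update ρ 0 b)) ∧
  -- (A4) foundation
  (∀ A : M, (∃ x, E x A) → ∃ x, E x A ∧ ∀ z, ¬ (E z x ∧ E z A)) ∧
  -- (A5) choice for sets
  (∀ x : M, IsSetB2 E x →
    (∀ y y', E y x → E y' x → y ≠ y' → ¬ ∃ z, E z y ∧ E z y') →
    ∃ x' : M, ∀ y, E y x → (∃ z, E z y) → ∃! z, E z y ∧ E z x')

end MarshallB2
/-- `V_α` as a collection of `ZFSet`s. -/
def Vset (α : Ordinal) : Set ZFSet := {x | x.rank < α}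

/-- `α` is `n`-extendible to `β`: there is an elementary embedding
`j : (V_{α+n}, ∈) → (V_{β+n}, ∈)` with critical point `α` and `j(α) = β` (ordinals are
identified inside `V` as the von Neumann ordinals, i.e. the `x` with `x.IsOrdinal`,
ordered by rank). -/
def NExtendibleTo (n : ℕ) (α β : Ordinal) : Prop :=
  α < β ∧ ∃ j : ZFSet → ZFSet,
    (∀ x, x ∈ Vset (α + n) → j x ∈ Vset (β + n)) ∧
    (∀ (φ : FOF) (ρ : ℕ → ZFSet), (∀ i, ρ i ∈ Vset (α + n)) →
      (FOF.Eval (· ∈ ·) (· ∈ Vset (α + n)) φ ρ ↔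
        FOF.Eval (· ∈ ·) (· ∈ Vset (β + n)) φ (fun i => j (ρ i)))) ∧
    (∀ x : ZFSet, x.IsOrdinal → x.rank < α → j x = x) ∧
    (∀ x : ZFSet, x.IsOrdinal → x.rank = α → (j x).IsOrdinal ∧ (j x).rank = β)

/-- `κ` is a limit of an `n`-extendible chain: there is `S ⊆ κ` cofinal in `κ` such that
whenever `α ∈ S`, `α < β` and `β ∈ S ∪ {κ}`, `α` is `n`-extendible to `β`. -/
def NExtendibleChainLimit (n : ℕ) (κ : Ordinal) : Prop :=
  ∃ S : Set Ordinal, S ⊆ Set.Iio κ ∧ (∀ γ < κ, ∃ α ∈ S, γ ≤ α) ∧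
    ∀ α ∈ S, ∀ β, α < β → (β ∈ S ∨ β = κ) → NExtendibleTo n α β

namespace FOF

theorem eval_congr {M : Type*} (E : M → M → Prop) (D : M → Prop) (φ : FOF) :
    ∀ {ρ σ : ℕ → M}, (∀ i ∈ φ.free, ρ i = σ i) → (φ.Eval E D ρ ↔ φ.Eval E D σ) := by
  have upd : ∀ (s : Set ℕ) (i : ℕ) (ρ σ : ℕ → M) (x : M), (∀ k ∈ s \ {i}, ρ k = σ k) →
      ∀ k ∈ s, Function.update ρ i x k = Function.update σ i x k := by
    intro s i ρ σ x h k hk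
    by_cases hki : k = i
    · simp [hki]
    · simp only [Function.update_of_ne hki]
      exact h k ⟨hk, hki⟩
  induction φ with
  | eq i j => intro ρ σ h; simp only [Eval, h i (by simp [free]), h j (by simp [free])]
  | mem i j => intro ρ σ h; simp only [Eval, h i (by simp [free]), h j (by simp [free])]
  | not φ ih => intro ρ σ h; exact not_congr (ih h)
  | and φ ψ ih₁ ih₂ =>
    intro ρ σ h
    exact and_congr (ih₁ fun i hi => h i (Or.inl hi)) (ih₂ fun i hi => h i (Or.inr hi))
  | or φ ψ ih₁ ih₂ =>
    intro ρ σ h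
    exact or_congr (ih₁ fun i hi => h i (Or.inl hi)) (ih₂ fun i hi => h i (Or.inr hi))
  | all i φ ih => intro ρ σ h; exact forall₂_congr fun x _ => ih (upd _ i ρ σ x h)
  | ex i φ ih =>
    intro ρ σ h
    exact exists_congr fun x => and_congr_right fun _ => ih (upd _ i ρ σ x h)

theorem exists_free_subset_Iio (φ : FOF) : ∃ n, φ.free ⊆ Set.Iio n := by
  have hfin : φ.free.Finite := by
    induction φ with
    | eq i j => simp [free]
    | mem i j => simp [free]
    | not φ ih => exact ih
    | and φ ψ ih₁ ih₂ => exact ih₁.union ih₂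
    | or φ ψ ih₁ ih₂ => exact ih₁.union ih₂
    | all i φ ih => exact ih.subset Set.sdiff_subset
    | ex i φ ih => exact ih.subset Set.sdiff_subset
  obtain ⟨n, hn⟩ := hfin.bddAbove
  exact ⟨n + 1, fun i hi => Nat.lt_succ_of_le (hn hi)⟩

/-- Satisfaction is invariant under isomorphism. -/
theorem eval_map {M N : Type*} {E : M → M → Prop} {F : N → N → Prop} {D : M → Prop}
    {D' : N → Prop} (f : M → N) (hD : ∀ x, D x → D' (f x)) (hsurj : ∀ y, D' y → ∃ x, D x ∧ f x = y)
    (hinj : ∀ x y, D x → D y → f x = f y → x = y)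
    (hmem : ∀ x y, D x → D y → (E x y ↔ F (f x) (f y))) (φ : FOF) :
    ∀ {ρ : ℕ → M}, (∀ i, D (ρ i)) → (φ.Eval E D ρ ↔ φ.Eval F D' (fun i => f (ρ i))) := by
  have upd : ∀ (ρ : ℕ → M) (i : ℕ) (x : M), (fun k => f (Function.update ρ i x k)) =
      Function.update (fun k => f (ρ k)) i (f x) := by
    intro ρ i x
    funext k
    by_cases hki : k = i
    · subst hki; simp
    · simp [Function.update_of_ne hki]
  have updD : ∀ (ρ : ℕ → M), (∀ i, D (ρ i)) → ∀ i x, D x → ∀ k, D (Function.update ρ i x k) := by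
    intro ρ hρ i x hx k
    by_cases hki : k = i
    · subst hki; simpa using hx
    · simpa [Function.update_of_ne hki] using hρ k
  induction φ with
  | eq i j => intro ρ hρ; exact ⟨fun h => congrArg f h, hinj _ _ (hρ i) (hρ j)⟩
  | mem i j => intro ρ hρ; exact hmem _ _ (hρ i) (hρ j)
  | not φ ih => intro ρ hρ; exact not_congr (ih hρ)
  | and φ ψ ih₁ ih₂ => intro ρ hρ; exact and_congr (ih₁ hρ) (ih₂ hρ)
  | or φ ψ ih₁ ih₂ => intro ρ hρ; exact or_congr (ih₁ hρ) (ih₂ hρ)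
  | all i φ ih =>
    intro ρ hρ
    constructor
    · intro h y hy
      obtain ⟨x, hx, rfl⟩ := hsurj y hy
      simpa only [upd] using (ih (updD ρ hρ i x hx)).1 (h x hx)
    · intro h x hx
      refine (ih (updD ρ hρ i x hx)).2 ?_
      simpa only [upd] using h (f x) (hD x hx)
  | ex i φ ih =>
    intro ρ hρ
    constructor
    · rintro ⟨x, hx, h⟩
      refine ⟨f x, hD x hx, ?_⟩
      simpa only [upd] using (ih (updD ρ hρ i x hx)).1 h
    · rintro ⟨y, hy, h⟩
      obtain ⟨x, hx, rfl⟩ := hsurj y hy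
      refine ⟨x, hx, (ih (updD ρ hρ i x hx)).2 ?_⟩
      simpa only [upd] using h

/-- The Tarski–Vaught criterion. -/
theorem eval_iff_of_tarskiVaught {M : Type*} {E : M → M → Prop} {U D : M → Prop}
    (hUD : ∀ x, U x → D x)
    (htv : ∀ (φ : FOF) (i : ℕ) (ρ : ℕ → M), (∀ k, U (ρ k)) →
      (∃ x, D x ∧ φ.Eval E D (Function.update ρ i x)) →
      ∃ x, U x ∧ φ.Eval E D (Function.update ρ i x)) (φ : FOF) :
    ∀ {ρ : ℕ → M}, (∀ i, U (ρ i)) → (φ.Eval E U ρ ↔ φ.Eval E D ρ) := by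
  have updU : ∀ (ρ : ℕ → M), (∀ i, U (ρ i)) → ∀ i x, U x → ∀ k, U (Function.update ρ i x k) := by
    intro ρ hρ i x hx k
    by_cases hki : k = i
    · subst hki; simpa using hx
    · simpa [Function.update_of_ne hki] using hρ k
  induction φ with
  | eq i j => intro ρ hρ; exact Iff.rfl
  | mem i j => intro ρ hρ; exact Iff.rfl
  | not φ ih => intro ρ hρ; exact not_congr (ih hρ)
  | and φ ψ ih₁ ih₂ => intro ρ hρ; exact and_congr (ih₁ hρ) (ih₂ hρ)
  | or φ ψ ih₁ ih₂ => intro ρ hρ; exact or_congr (ih₁ hρ) (ih₂ hρ)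
  | all i φ ih =>
    intro ρ hρ
    constructor
    · intro h
      by_contra hcon
      obtain ⟨x, hx, hn⟩ : ∃ x, D x ∧ (FOF.not φ).Eval E D (Function.update ρ i x) := by
        simpa [Eval] using hcon
      obtain ⟨y, hy, hny⟩ := htv φ.not i ρ hρ ⟨x, hx, hn⟩
      exact hny ((ih (updU ρ hρ i y hy)).1 (h y hy))
    · exact fun h x hx => (ih (updU ρ hρ i x hx)).2 (h x (hUD x hx))
  | ex i φ ih =>
    intro ρ hρ
    constructor
    · rintro ⟨x, hx, h⟩
      exact ⟨x, hUD x hx, (ih (updU ρ hρ i x hx)).1 h⟩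
    · rintro h
      obtain ⟨x, hx, h⟩ := htv φ i ρ hρ h
      exact ⟨x, hx, (ih (updU ρ hρ i x hx)).2 h⟩

/-- A Gödel numbering of formulas. -/
def code : FOF → ℕ
  | .eq i j => Nat.pair 0 (Nat.pair i j)
  | .mem i j => Nat.pair 1 (Nat.pair i j)
  | .not φ => Nat.pair 2 φ.code
  | .and φ ψ => Nat.pair 3 (Nat.pair φ.code ψ.code)
  | .or φ ψ => Nat.pair 4 (Nat.pair φ.code ψ.code)
  | .all i φ => Nat.pair 5 (Nat.pair i φ.code)
  | .ex i φ => Nat.pair 6 (Nat.pair i φ.code)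

theorem code_injective : Function.Injective code := by
  intro φ
  induction φ with
  | eq i j => intro ψ h; cases ψ <;> simp_all [code, Nat.pair_eq_pair]
  | mem i j => intro ψ h; cases ψ <;> simp_all [code, Nat.pair_eq_pair]
  | not φ ih =>
    intro ψ h
    cases ψ <;> simp only [code, Nat.pair_eq_pair] at h <;> try omega
    rw [ih h.2]
  | and φ φ' ih ih' =>
    intro ψ h
    cases ψ <;> simp only [code, Nat.pair_eq_pair] at h <;> try omega
    rw [ih h.2.1, ih' h.2.2]
  | or φ φ' ih ih' =>
    intro ψ h
    cases ψ <;> simp only [code, Nat.pair_eq_pair] at h <;> try omega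
    rw [ih h.2.1, ih' h.2.2]
  | all i φ ih =>
    intro ψ h
    cases ψ <;> simp only [code, Nat.pair_eq_pair] at h <;> try omega
    rw [h.2.1, ih h.2.2]
  | ex i φ ih =>
    intro ψ h
    cases ψ <;> simp only [code, Nat.pair_eq_pair] at h <;> try omega
    rw [h.2.1, ih h.2.2]

end FOF

/-- Contexts of variables for set-theoretic formulas: `read ρ` is the tuple of the values of the
first `size` variables under the assignment `ρ`. -/
class FOFContext (Γ : Type*) where
  size : ℕ
  read : (ℕ → ZFSet.{u}) → Γ
  read_congr : ∀ {ρ σ : ℕ → ZFSet.{u}}, (∀ i < size, ρ i = σ i) → read ρ = read σ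

instance : FOFContext.{u} ZFSet.{u} where
  size := 1
  read ρ := ρ 0
  read_congr h := h 0 one_pos

instance {Γ : Type*} [FOFContext.{u} Γ] : FOFContext.{u} (Γ × ZFSet.{u}) where
  size := FOFContext.size.{u} Γ + 1
  read ρ := (FOFContext.read ρ, ρ (FOFContext.size.{u} Γ))
  read_congr h := Prod.ext (FOFContext.read_congr fun i hi => h i (hi.trans (Nat.lt_succ_self _)))
    (h _ (Nat.lt_succ_self _))

namespace FOFContext

variable {Γ : Type*} [FOFContext.{u} Γ]

/-- `v` is one of the variables of the context. -/
def IsVar (v : Γ → ZFSet.{u}) : Prop :=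
  ∃ i < size.{u} Γ, ∀ ρ, v (read ρ) = ρ i

/-- A predicate relativized to a varying collection `D` is expressed, uniformly in `D`, by a
formula of set theory. -/
def Expressible (P : (ZFSet.{u} → Prop) → Γ → Prop) : Prop :=
  ∃ φ : FOF, φ.free ⊆ Set.Iio (size.{u} Γ) ∧ ∀ D ρ, φ.Eval (· ∈ ·) D ρ ↔ P D (read ρ)

theorem isVar_id : IsVar (fun x : ZFSet.{u} => x) := ⟨0, one_pos, fun _ => rfl⟩

theorem isVar_snd : IsVar (fun p : Γ × ZFSet.{u} => p.2) :=
  ⟨size.{u} Γ, Nat.lt_succ_self _, fun _ => rfl⟩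

theorem IsVar.fst {v : Γ → ZFSet.{u}} (hv : IsVar v) : IsVar (fun p : Γ × ZFSet.{u} => v p.1) := by
  obtain ⟨i, hi, h⟩ := hv
  exact ⟨i, hi.trans (Nat.lt_succ_self _), h⟩

namespace Expressible

theorem mem {v v' : Γ → ZFSet.{u}} (hv : IsVar v) (hv' : IsVar v') :
    Expressible (fun _ g => v g ∈ v' g) := by
  obtain ⟨i, hi, h⟩ := hv
  obtain ⟨j, hj, h'⟩ := hv'
  exact ⟨.mem i j, by simp [FOF.free, Set.insert_subset_iff, hi, hj], by simp [FOF.Eval, h, h']⟩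

theorem eq {v v' : Γ → ZFSet.{u}} (hv : IsVar v) (hv' : IsVar v') :
    Expressible (fun _ g => v g = v' g) := by
  obtain ⟨i, hi, h⟩ := hv
  obtain ⟨j, hj, h'⟩ := hv'
  exact ⟨.eq i j, by simp [FOF.free, Set.insert_subset_iff, hi, hj], by simp [FOF.Eval, h, h']⟩

theorem not {P : (ZFSet.{u} → Prop) → Γ → Prop} (hP : Expressible P) :
    Expressible (fun D g => ¬ P D g) := by
  obtain ⟨φ, hφ, h⟩ := hP
  exact ⟨.not φ, hφ, fun D ρ => not_congr (h D ρ)⟩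

theorem and {P Q : (ZFSet.{u} → Prop) → Γ → Prop} (hP : Expressible P) (hQ : Expressible Q) :
    Expressible (fun D g => P D g ∧ Q D g) := by
  obtain ⟨φ, hφ, h⟩ := hP
  obtain ⟨ψ, hψ, h'⟩ := hQ
  exact ⟨.and φ ψ, Set.union_subset hφ hψ, fun D ρ => and_congr (h D ρ) (h' D ρ)⟩

theorem or {P Q : (ZFSet.{u} → Prop) → Γ → Prop} (hP : Expressible P) (hQ : Expressible Q) :
    Expressible (fun D g => P D g ∨ Q D g) := by
  obtain ⟨φ, hφ, h⟩ := hP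
  obtain ⟨ψ, hψ, h'⟩ := hQ
  exact ⟨.or φ ψ, Set.union_subset hφ hψ, fun D ρ => or_congr (h D ρ) (h' D ρ)⟩

theorem imp {P Q : (ZFSet.{u} → Prop) → Γ → Prop} (hP : Expressible P) (hQ : Expressible Q) :
    Expressible (fun D g => P D g → Q D g) := by
  simpa only [imp_iff_not_or] using hP.not.or hQ

theorem iff {P Q : (ZFSet.{u} → Prop) → Γ → Prop} (hP : Expressible P) (hQ : Expressible Q) :
    Expressible (fun D g => P D g ↔ Q D g) := by
  simpa only [iff_iff_implies_and_implies] using (hP.imp hQ).and (hQ.imp hP)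

theorem read_update (ρ : ℕ → ZFSet.{u}) (x : ZFSet.{u}) :
    (read (Function.update ρ (size.{u} Γ) x) : Γ × ZFSet.{u}) = (read ρ, x) := by
  refine Prod.ext (read_congr fun i hi => ?_) ?_
  · exact Function.update_of_ne hi.ne _ _
  · exact Function.update_self _ _ _

theorem diff_subset_Iio {s : Set ℕ} {n : ℕ} (h : s ⊆ Set.Iio (n + 1)) : s \ {n} ⊆ Set.Iio n :=
  fun _ hi => lt_of_le_of_ne (Nat.lt_succ_iff.1 (h hi.1)) hi.2

theorem ex {P : (ZFSet.{u} → Prop) → Γ → ZFSet.{u} → Prop}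
    (hP : Expressible (fun D (p : Γ × ZFSet.{u}) => P D p.1 p.2)) :
    Expressible (fun D g => ∃ x, D x ∧ P D g x) := by
  obtain ⟨φ, hφ, h⟩ := hP
  refine ⟨.ex (size.{u} Γ) φ, diff_subset_Iio hφ, fun D ρ => ?_⟩
  simp only [FOF.Eval, h, read_update]

theorem all {P : (ZFSet.{u} → Prop) → Γ → ZFSet.{u} → Prop}
    (hP : Expressible (fun D (p : Γ × ZFSet.{u}) => P D p.1 p.2)) :
    Expressible (fun D g => ∀ x, D x → P D g x) := by
  obtain ⟨φ, hφ, h⟩ := hP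
  refine ⟨.all (size.{u} Γ) φ, diff_subset_Iio hφ, fun D ρ => ?_⟩
  simp only [FOF.Eval, h, read_update]

end Expressible

end FOFContext

namespace MarshallB2

open FOFContext

/-- The ordered pair `[x, y] = x × {0} ∪ y × {1}` of classes. -/
noncomputable def cpair (x y : ZFSet.{u}) : ZFSet.{u} := x.prod {∅} ∪ y.prod {{∅}}

/-- The `k`-fold singleton of the empty set, used as a name for the natural number `k`. -/
noncomputable def num : ℕ → ZFSet.{u}
  | 0 => ∅
  | k + 1 => {num k}

theorem singleton_ne_empty (x : ZFSet.{u}) : ({x} : ZFSet.{u}) ≠ ∅ :=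
  fun h => ZFSet.notMem_empty x (h ▸ ZFSet.mem_singleton.2 rfl)

theorem mem_cpair {x y z : ZFSet.{u}} :
    z ∈ cpair x y ↔ (∃ a ∈ x, z = a.pair ∅) ∨ ∃ b ∈ y, z = b.pair {∅} := by
  simp [cpair, ZFSet.mem_prod]

theorem pair_empty_mem_cpair {x y a : ZFSet.{u}} : a.pair ∅ ∈ cpair x y ↔ a ∈ x := by
  have h : (∅ : ZFSet.{u}) ≠ {∅} := (singleton_ne_empty _).symm
  simp [mem_cpair, ZFSet.pair_inj, h]

theorem pair_singleton_mem_cpair {x y b : ZFSet.{u}} : b.pair {∅} ∈ cpair x y ↔ b ∈ y := by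
  have h : ({∅} : ZFSet.{u}) ≠ ∅ := (singleton_ne_empty _)
  simp [mem_cpair, ZFSet.pair_inj, h]

theorem cpair_inj {x y x' y' : ZFSet.{u}} : cpair x y = cpair x' y' ↔ x = x' ∧ y = y' := by
  refine ⟨fun h => ⟨?_, ?_⟩, fun h => by rw [h.1, h.2]⟩
  · ext a
    rw [← pair_empty_mem_cpair (y := y), h, pair_empty_mem_cpair]
  · ext a
    rw [← pair_singleton_mem_cpair (x := x), h, pair_singleton_mem_cpair]

theorem num_injective : Function.Injective num.{u} := by
  intro k
  induction k with
  | zero =>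
    intro l h
    cases l with
    | zero => rfl
    | succ l => exact absurd h (singleton_ne_empty _).symm
  | succ k ih =>
    intro l h
    cases l with
    | zero => exact absurd h (singleton_ne_empty _)
    | succ l => rw [ih (ZFSet.singleton_injective h)]

/-- `x` is a class, relative to `D`. -/
def IsCls (D : ZFSet.{u} → Prop) (x : ZFSet.{u}) : Prop := ∃ c, D c ∧ x ∈ c

/-- `x` is a set, relative to `D`. -/
def IsSt (D : ZFSet.{u} → Prop) (x : ZFSet.{u}) : Prop := ∃ c, D c ∧ IsCls D c ∧ x ∈ c

/-- `x = num k`, relative to `D`. -/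
def IsNum (D : ZFSet.{u} → Prop) : ℕ → ZFSet.{u} → Prop
  | 0, x => ∀ z, D z → ¬ z ∈ x
  | k + 1, x => ∃ y, D y ∧ IsNum D k y ∧ ∀ z, D z → (z ∈ x ↔ z = y)

/-- `z` is the Kuratowski pair of `a` and `t`, relative to `D`. -/
def IsKpair (D : ZFSet.{u} → Prop) (z a t : ZFSet.{u}) : Prop :=
  ∀ v, D v → (v ∈ z ↔ (∀ y, D y → (y ∈ v ↔ y = a)) ∨ ∀ y, D y → (y ∈ v ↔ (y = a ∨ y = t)))

/-- `z` is the Kuratowski pair of `a` and `num k`, relative to `D`. -/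
def IsKpairNum (D : ZFSet.{u} → Prop) (k : ℕ) (z a : ZFSet.{u}) : Prop :=
  ∃ t, D t ∧ IsNum D k t ∧ IsKpair D z a t

/-- `p = [x, y]`, relative to `D`. -/
def IsCpair (D : ZFSet.{u} → Prop) (p x y : ZFSet.{u}) : Prop :=
  IsCls D p ∧ IsCls D x ∧ IsCls D y ∧
  (∀ a, D a → a ∈ x → ∃ z, D z ∧ z ∈ p ∧ IsKpairNum D 0 z a) ∧
  (∀ a, D a → a ∈ y → ∃ z, D z ∧ z ∈ p ∧ IsKpairNum D 1 z a) ∧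
  ∀ z, D z → z ∈ p → (∃ a, D a ∧ a ∈ x ∧ IsKpairNum D 0 z a) ∨
    ∃ a, D a ∧ a ∈ y ∧ IsKpairNum D 1 z a

/-- `[num k, [c, s]] ∈ A`, relative to `D`. -/
def HasEntry (D : ZFSet.{u} → Prop) (k : ℕ) (A c s : ZFSet.{u}) : Prop :=
  ∃ t, D t ∧ IsNum D k t ∧ ∃ q, D q ∧ IsCpair D q c s ∧ ∃ p, D p ∧ IsCpair D p t q ∧ p ∈ A

/-- There are sets, and each set `x` is a member of a set that contains the union of `x`,
relative to `D`. -/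
def SetsClosed (D : ZFSet.{u} → Prop) : Prop :=
  (∃ x, D x ∧ IsSt D x) ∧
  ∀ x, D x → IsSt D x → ∃ y, D y ∧ IsSt D y ∧ x ∈ y ∧
    ∀ a, D a → a ∈ x → ∀ b, D b → b ∈ a → b ∈ y

/-- `A` codes a family of predicates (`num 0`), their complements (`num 2`), their existential
quantifications (`num 3`), and the family of all classes (`num 1`), relative to `D`. -/
def CodesPredicates (D : ZFSet.{u} → Prop) (A : ZFSet.{u}) : Prop :=
  (∀ c, D c → ∀ s, D s → ¬ (HasEntry D 0 A c s ∧ HasEntry D 2 A c s)) ∧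
  (∀ c, D c → ∀ s, D s → HasEntry D 3 A c s →
    ∃ e, D e ∧ e ∈ A ∧ ∃ q, D q ∧ IsCpair D q e s ∧ HasEntry D 0 A c q) ∧
  ∀ x, D x → IsCls D x → ∃ t, D t ∧ IsNum D 1 t ∧ ∃ p, D p ∧ IsCpair D p t x ∧ p ∈ A

section Expressible

variable {Γ : Type (u + 1)} [FOFContext.{u} Γ]

theorem expressible_isCls {v : Γ → ZFSet.{u}} (hv : IsVar v) :
    Expressible (fun D g => IsCls D (v g)) :=
  .ex (.mem hv.fst isVar_snd)

theorem expressible_isSt {v : Γ → ZFSet.{u}} (hv : IsVar v) :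
    Expressible (fun D g => IsSt D (v g)) :=
  .ex (.and (expressible_isCls isVar_snd) (.mem hv.fst isVar_snd))

theorem expressible_isNum (k : ℕ) {Γ : Type (u + 1)} [FOFContext.{u} Γ] {v : Γ → ZFSet.{u}}
    (hv : IsVar v) : Expressible (fun D g => IsNum D k (v g)) := by
  induction k generalizing Γ with
  | zero => exact .all (.not (.mem isVar_snd hv.fst))
  | succ k ih =>
    exact .ex (.and (ih isVar_snd) (.all (.iff (.mem isVar_snd hv.fst.fst)
      (.eq isVar_snd isVar_snd.fst))))

theorem expressible_isKpair {z a t : Γ → ZFSet.{u}} (hz : IsVar z) (ha : IsVar a) (ht : IsVar t) :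
    Expressible (fun D g => IsKpair D (z g) (a g) (t g)) :=
  .all (.iff (.mem isVar_snd hz.fst) (.or
    (.all (.iff (.mem isVar_snd isVar_snd.fst) (.eq isVar_snd ha.fst.fst)))
    (.all (.iff (.mem isVar_snd isVar_snd.fst)
      (.or (.eq isVar_snd ha.fst.fst) (.eq isVar_snd ht.fst.fst))))))

theorem expressible_isKpairNum (k : ℕ) {z a : Γ → ZFSet.{u}} (hz : IsVar z) (ha : IsVar a) :
    Expressible (fun D g => IsKpairNum D k (z g) (a g)) :=
  .ex (.and (expressible_isNum k isVar_snd) (expressible_isKpair hz.fst ha.fst isVar_snd))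

theorem expressible_isCpair {p x y : Γ → ZFSet.{u}} (hp : IsVar p) (hx : IsVar x) (hy : IsVar y) :
    Expressible (fun D g => IsCpair D (p g) (x g) (y g)) :=
  .and (expressible_isCls hp) (.and (expressible_isCls hx) (.and (expressible_isCls hy) (.and
    (.all (.imp (.mem isVar_snd hx.fst) (.ex (.and (.mem isVar_snd hp.fst.fst)
      (expressible_isKpairNum 0 isVar_snd isVar_snd.fst))))) (.and
    (.all (.imp (.mem isVar_snd hy.fst) (.ex (.and (.mem isVar_snd hp.fst.fst)
      (expressible_isKpairNum 1 isVar_snd isVar_snd.fst)))))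
    (.all (.imp (.mem isVar_snd hp.fst) (.or
      (.ex (.and (.mem isVar_snd hx.fst.fst) (expressible_isKpairNum 0 isVar_snd.fst isVar_snd)))
      (.ex (.and (.mem isVar_snd hy.fst.fst)
        (expressible_isKpairNum 1 isVar_snd.fst isVar_snd))))))))))

theorem expressible_hasEntry (k : ℕ) {A c s : Γ → ZFSet.{u}} (hA : IsVar A) (hc : IsVar c)
    (hs : IsVar s) : Expressible (fun D g => HasEntry D k (A g) (c g) (s g)) :=
  .ex (.and (expressible_isNum k isVar_snd) (.ex (.and
    (expressible_isCpair isVar_snd hc.fst.fst hs.fst.fst) (.ex (.and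
      (expressible_isCpair isVar_snd isVar_snd.fst.fst isVar_snd.fst)
      (.mem isVar_snd hA.fst.fst.fst))))))

theorem expressible_setsClosed : Expressible (fun D (_ : Γ) => SetsClosed D) :=
  .and (.ex (expressible_isSt isVar_snd))
    (.all (.imp (expressible_isSt isVar_snd) (.ex (.and (expressible_isSt isVar_snd) (.and
      (.mem isVar_snd.fst isVar_snd) (.all (.imp (.mem isVar_snd isVar_snd.fst.fst)
        (.all (.imp (.mem isVar_snd isVar_snd.fst) (.mem isVar_snd isVar_snd.fst.fst))))))))))

theorem expressible_codesPredicates {A : Γ → ZFSet.{u}} (hA : IsVar A) :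
    Expressible (fun D g => CodesPredicates D (A g)) :=
  .and (.all (.all (.not (.and (expressible_hasEntry 0 hA.fst.fst isVar_snd.fst isVar_snd)
      (expressible_hasEntry 2 hA.fst.fst isVar_snd.fst isVar_snd))))) (.and
    (.all (.all (.imp (expressible_hasEntry 3 hA.fst.fst isVar_snd.fst isVar_snd)
      (.ex (.and (.mem isVar_snd hA.fst.fst.fst) (.ex (.and
        (expressible_isCpair isVar_snd isVar_snd.fst isVar_snd.fst.fst)
        (expressible_hasEntry 0 hA.fst.fst.fst.fst isVar_snd.fst.fst.fst isVar_snd))))))))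
    (.all (.imp (expressible_isCls isVar_snd) (.ex (.and (expressible_isNum 1 isVar_snd)
      (.ex (.and (expressible_isCpair isVar_snd isVar_snd.fst isVar_snd.fst.fst)
        (.mem isVar_snd hA.fst.fst.fst))))))))

end Expressible

/-- The collection of 2-classes over `w`, i.e. the double power set of `w`. -/
def TwoClass (w x : ZFSet.{u}) : Prop := ∀ y ∈ x, ∀ z ∈ y, z ∈ w

theorem isCls_twoClass {w x : ZFSet.{u}} : IsCls (TwoClass w) x ↔ x ⊆ w := by
  constructor
  · rintro ⟨c, hc, hx⟩
    exact hc x hx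
  · refine fun h => ⟨{x}, fun y hy => ?_, ZFSet.mem_singleton.2 rfl⟩
    rw [ZFSet.mem_singleton.1 hy]
    exact h

/-- Transitive sets closed under subsets of their elements. -/
structure Supertransitive (w : ZFSet.{u}) : Prop where
  trans : ∀ y ∈ w, ∀ z ∈ y, z ∈ w
  subset : ∀ y ∈ w, ∀ x ⊆ y, x ∈ w

/-- Supertransitive sets over which the pairing of classes is absolute. -/
structure PairClosed (w : ZFSet.{u}) : Prop extends Supertransitive w where
  empty : ∅ ∈ w
  pair_empty : ∀ a ∈ w, a.pair ∅ ∈ w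
  pair_singleton : ∀ a ∈ w, a.pair {∅} ∈ w

namespace Supertransitive

variable {w : ZFSet.{u}} (hw : Supertransitive w)

include hw

theorem twoClass_of_subset {x : ZFSet.{u}} (hx : x ⊆ w) : TwoClass w x :=
  fun y hy => hw.trans y (hx hy)

theorem twoClass_of_mem {x : ZFSet.{u}} (hx : x ∈ w) : TwoClass w x :=
  hw.twoClass_of_subset (hw.trans x hx)

theorem isSt_iff {x : ZFSet.{u}} : IsSt (TwoClass w) x ↔ x ∈ w := by
  constructor
  · rintro ⟨c, -, hc, hx⟩
    exact isCls_twoClass.1 hc hx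
  · exact fun h => ⟨w, hw.twoClass_of_subset (fun _ => id), isCls_twoClass.2 fun _ => id, h⟩

theorem setsClosed_iff : SetsClosed (TwoClass w) ↔ (∃ x, x ∈ w) ∧
    ∀ x ∈ w, ∃ y ∈ w, x ∈ y ∧ ∀ a ∈ x, ∀ b ∈ a, b ∈ y := by
  simp only [SetsClosed, hw.isSt_iff]
  refine and_congr (exists_congr fun x => ⟨And.right, fun h => ⟨hw.twoClass_of_mem h, h⟩⟩) ?_
  constructor
  · intro h x hx
    obtain ⟨y, -, hyw, hxy, hy⟩ := h x (hw.twoClass_of_mem hx) hx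
    refine ⟨y, hyw, hxy, fun a ha b hb => ?_⟩
    have haw := hw.trans x hx a ha
    exact hy a (hw.twoClass_of_mem haw) ha b (hw.twoClass_of_mem (hw.trans a haw b hb)) hb
  · intro h x _ hx
    obtain ⟨y, hyw, hxy, hy⟩ := h x hx
    exact ⟨y, hw.twoClass_of_mem hyw, hyw, hxy, fun a _ ha b _ hb => hy a ha b hb⟩

end Supertransitive

namespace PairClosed

variable {w : ZFSet.{u}} (hw : PairClosed w)

include hw

theorem singleton_mem {a : ZFSet.{u}} (ha : a ∈ w) : {a} ∈ w :=
  hw.trans _ (hw.pair_empty a ha) _ (by simp [ZFSet.pair])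

theorem num_mem (k : ℕ) : num k ∈ w := by
  induction k with
  | zero => exact hw.empty
  | succ k ih => exact hw.singleton_mem ih

theorem isNum_iff (k : ℕ) {x : ZFSet.{u}} (hx : TwoClass w x) :
    IsNum (TwoClass w) k x ↔ x = num k := by
  have hmem : ∀ {x}, TwoClass w x → ∀ z ∈ x, TwoClass w z :=
    fun hx z hz => hw.twoClass_of_subset (hx z hz)
  induction k generalizing x with
  | zero =>
    simp only [IsNum, num, ZFSet.eq_empty]
    exact ⟨fun h z hz => h z (hmem hx z hz) hz, fun h z _ => h z⟩
  | succ k ih =>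
    simp only [IsNum, num]
    have hk : TwoClass w (num k) := hw.twoClass_of_mem (hw.num_mem k)
    constructor
    · rintro ⟨y, hy, hyk, h⟩
      obtain rfl := (ih hy).1 hyk
      ext z
      rw [ZFSet.mem_singleton]
      exact ⟨fun hz => (h z (hmem hx z hz)).1 hz, fun hz => hz ▸ (h _ hk).2 rfl⟩
    · rintro rfl
      exact ⟨num k, hk, (ih hk).2 rfl, fun z _ => ZFSet.mem_singleton⟩

theorem isKpair_iff {z a t : ZFSet.{u}} (hz : z ⊆ w) (ha : a ∈ w) (ht : t ∈ w) :
    IsKpair (TwoClass w) z a t ↔ z = a.pair t := by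
  have hDa := hw.twoClass_of_mem ha
  have hDt := hw.twoClass_of_mem ht
  have h1 : ∀ v, TwoClass w v →
      ((∀ y, TwoClass w y → (y ∈ v ↔ y = a)) ↔ v = {a}) := by
    intro v hv
    constructor
    · intro h
      ext y
      rw [ZFSet.mem_singleton]
      exact ⟨fun hy => (h y (hw.twoClass_of_subset (hv y hy))).1 hy, fun hy => hy ▸ (h a hDa).2 rfl⟩
    · rintro rfl y -
      exact ZFSet.mem_singleton
  have h2 : ∀ v, TwoClass w v →
      ((∀ y, TwoClass w y → (y ∈ v ↔ (y = a ∨ y = t))) ↔ v = {a, t}) := by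
    intro v hv
    constructor
    · intro h
      ext y
      rw [ZFSet.mem_pair]
      refine ⟨fun hy => (h y (hw.twoClass_of_subset (hv y hy))).1 hy, ?_⟩
      rintro (rfl | rfl)
      · exact (h _ hDa).2 (Or.inl rfl)
      · exact (h _ hDt).2 (Or.inr rfl)
    · rintro rfl y -
      exact ZFSet.mem_pair
  constructor
  · intro h
    ext v
    rw [ZFSet.pair, ZFSet.mem_pair]
    refine ⟨fun hv => ?_, fun hv => ?_⟩
    · have hDv := hw.twoClass_of_mem (hz hv)
      rw [← h1 v hDv, ← h2 v hDv]
      exact (h v hDv).1 hv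
    · have hDv : TwoClass w v := by
        refine hw.twoClass_of_subset fun y hy => ?_
        rcases hv with rfl | rfl
        · exact ZFSet.mem_singleton.1 hy ▸ ha
        · rcases ZFSet.mem_pair.1 hy with rfl | rfl
          · exact ha
          · exact ht
      rw [← h1 v hDv, ← h2 v hDv] at hv
      exact (h v hDv).2 hv
  · rintro rfl v hDv
    rw [h1 v hDv, h2 v hDv, ZFSet.pair, ZFSet.mem_pair]

theorem isKpairNum_iff (k : ℕ) {z a : ZFSet.{u}} (hz : z ⊆ w) (ha : a ∈ w) :
    IsKpairNum (TwoClass w) k z a ↔ z = a.pair (num k) := by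
  have hk := hw.num_mem k
  constructor
  · rintro ⟨t, ht, htk, h⟩
    obtain rfl := (hw.isNum_iff k ht).1 htk
    exact (hw.isKpair_iff hz ha hk).1 h
  · intro h
    exact ⟨num k, hw.twoClass_of_mem hk, (hw.isNum_iff k (hw.twoClass_of_mem hk)).2 rfl,
      (hw.isKpair_iff hz ha hk).2 h⟩

theorem cpair_subset {x y : ZFSet.{u}} (hx : x ⊆ w) (hy : y ⊆ w) : cpair x y ⊆ w := by
  intro z hz
  rcases mem_cpair.1 hz with ⟨a, ha, rfl⟩ | ⟨a, ha, rfl⟩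
  · exact hw.pair_empty a (hx ha)
  · exact hw.pair_singleton a (hy ha)

theorem isCpair_iff {p x y : ZFSet.{u}} :
    IsCpair (TwoClass w) p x y ↔ x ⊆ w ∧ y ⊆ w ∧ p = cpair x y := by
  simp only [IsCpair, isCls_twoClass]
  constructor
  · rintro ⟨hp, hx, hy, h0, h1, h⟩
    have hpw : ∀ z ∈ p, z ⊆ w := fun z hz => hw.trans z (hp hz)
    refine ⟨hx, hy, ?_⟩
    ext z
    rw [mem_cpair]
    constructor
    · intro hz
      refine (h z (hw.twoClass_of_mem (hp hz)) hz).imp ?_ ?_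
      · rintro ⟨a, -, ha, h⟩
        exact ⟨a, ha, (hw.isKpairNum_iff 0 (hpw z hz) (hx ha)).1 h⟩
      · rintro ⟨a, -, ha, h⟩
        exact ⟨a, ha, (hw.isKpairNum_iff 1 (hpw z hz) (hy ha)).1 h⟩
    · rintro (⟨a, ha, rfl⟩ | ⟨a, ha, rfl⟩)
      · obtain ⟨z, -, hz, h⟩ := h0 a (hw.twoClass_of_mem (hx ha)) ha
        rw [hw.isKpairNum_iff 0 (hpw z hz) (hx ha)] at h
        exact h ▸ hz
      · obtain ⟨z, -, hz, h⟩ := h1 a (hw.twoClass_of_mem (hy ha)) ha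
        rw [hw.isKpairNum_iff 1 (hpw z hz) (hy ha)] at h
        exact h ▸ hz
  · rintro ⟨hx, hy, rfl⟩
    have hp := hw.cpair_subset hx hy
    have hpw : ∀ z ∈ cpair x y, z ⊆ w := fun z hz => hw.trans z (hp hz)
    refine ⟨hp, hx, hy, fun a _ ha => ?_, fun a _ ha => ?_, fun z _ hz => ?_⟩
    · have hz := (pair_empty_mem_cpair (y := y)).2 ha
      exact ⟨_, hw.twoClass_of_mem (hp hz), hz, (hw.isKpairNum_iff 0 (hpw _ hz) (hx ha)).2 rfl⟩
    · have hz := (pair_singleton_mem_cpair (x := x)).2 ha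
      exact ⟨_, hw.twoClass_of_mem (hp hz), hz, (hw.isKpairNum_iff 1 (hpw _ hz) (hy ha)).2 rfl⟩
    · rcases mem_cpair.1 hz with ⟨a, ha, h⟩ | ⟨a, ha, h⟩
      · exact Or.inl ⟨a, hw.twoClass_of_mem (hx ha), ha,
          (hw.isKpairNum_iff 0 (hpw z hz) (hx ha)).2 h⟩
      · exact Or.inr ⟨a, hw.twoClass_of_mem (hy ha), ha,
          (hw.isKpairNum_iff 1 (hpw z hz) (hy ha)).2 h⟩

theorem hasEntry_iff (k : ℕ) {A c s : ZFSet.{u}} : HasEntry (TwoClass w) k A c s ↔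
    c ⊆ w ∧ s ⊆ w ∧ cpair (num k) (cpair c s) ∈ A := by
  have hk := hw.num_mem k
  constructor
  · rintro ⟨t, ht, htk, q, -, hq, p, -, hp, hpA⟩
    obtain rfl := (hw.isNum_iff k ht).1 htk
    obtain ⟨hc, hs, rfl⟩ := hw.isCpair_iff.1 hq
    obtain ⟨-, -, rfl⟩ := hw.isCpair_iff.1 hp
    exact ⟨hc, hs, hpA⟩
  · rintro ⟨hc, hs, h⟩
    have hkw : num k ⊆ w := hw.trans _ hk
    have hq := hw.cpair_subset hc hs
    exact ⟨_, hw.twoClass_of_mem hk, (hw.isNum_iff k (hw.twoClass_of_mem hk)).2 rfl, _,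
      hw.twoClass_of_subset hq, hw.isCpair_iff.2 ⟨hc, hs, rfl⟩, _,
      hw.twoClass_of_subset (hw.cpair_subset hkw hq), hw.isCpair_iff.2 ⟨hkw, hq, rfl⟩, h⟩

theorem codesPredicates_iff {A : ZFSet.{u}} (hA : TwoClass w A) :
    CodesPredicates (TwoClass w) A ↔
      (∀ c ⊆ w, ∀ s ⊆ w, ¬ (cpair (num 0) (cpair c s) ∈ A ∧ cpair (num 2) (cpair c s) ∈ A)) ∧
      (∀ c ⊆ w, ∀ s ⊆ w, cpair (num 3) (cpair c s) ∈ A →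
        ∃ e ∈ A, cpair (num 0) (cpair c (cpair e s)) ∈ A) ∧
      ∀ x ⊆ w, cpair (num 1) x ∈ A := by
  have hD : ∀ {x}, x ⊆ w → TwoClass w x := hw.twoClass_of_subset
  have h1 := hw.num_mem 1
  have h1w : num 1 ⊆ w := hw.trans _ h1
  simp only [CodesPredicates, hw.hasEntry_iff, isCls_twoClass]
  refine and_congr ?_ (and_congr ?_ ?_)
  · constructor
    · exact fun h c hc s hs h' => h c (hD hc) s (hD hs) ⟨⟨hc, hs, h'.1⟩, hc, hs, h'.2⟩
    · exact fun h c _ s _ h' => h c h'.1.1 s h'.1.2.1 ⟨h'.1.2.2, h'.2.2.2⟩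
  · constructor
    · intro h c hc s hs h'
      obtain ⟨e, -, he, q, -, hq, -, -, hqA⟩ := h c (hD hc) s (hD hs) ⟨hc, hs, h'⟩
      obtain ⟨-, -, rfl⟩ := hw.isCpair_iff.1 hq
      exact ⟨e, he, hqA⟩
    · rintro h c - s - ⟨hc, hs, h'⟩
      obtain ⟨e, he, heA⟩ := h c hc s hs h'
      have hew : e ⊆ w := hA e he
      have hq := hw.cpair_subset hew hs
      exact ⟨e, hD hew, he, _, hD hq, hw.isCpair_iff.2 ⟨hew, hs, rfl⟩, hc, hq, heA⟩
  · constructor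
    · intro h x hx
      obtain ⟨t, ht, ht1, p, -, hp, hpA⟩ := h x (hD hx) hx
      obtain rfl := (hw.isNum_iff 1 ht).1 ht1
      obtain ⟨-, -, rfl⟩ := hw.isCpair_iff.1 hp
      exact hpA
    · intro h x _ hx
      exact ⟨_, hw.twoClass_of_mem h1, (hw.isNum_iff 1 (hw.twoClass_of_mem h1)).2 rfl, _,
        hD (hw.cpair_subset h1w hx), hw.isCpair_iff.2 ⟨h1w, hx, rfl⟩, h x hx⟩

theorem cpair_inter (x y : ZFSet.{u}) : cpair x y ∩ w = cpair (x ∩ w) (y ∩ w) := by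
  have h0 : ∀ a : ZFSet.{u}, ∀ t, a.pair t ∈ w → a ∈ w := fun a t h =>
    hw.trans _ (hw.trans _ h {a} (by simp [ZFSet.pair])) a (ZFSet.mem_singleton.2 rfl)
  ext z
  simp only [ZFSet.mem_inter, mem_cpair]
  constructor
  · rintro ⟨⟨a, ha, rfl⟩ | ⟨a, ha, rfl⟩, hz⟩
    · exact Or.inl ⟨a, ⟨ha, h0 _ _ hz⟩, rfl⟩
    · exact Or.inr ⟨a, ⟨ha, h0 _ _ hz⟩, rfl⟩
  · rintro (⟨a, ⟨ha, haw⟩, rfl⟩ | ⟨a, ⟨ha, haw⟩, rfl⟩)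
    · exact ⟨Or.inl ⟨a, ha, rfl⟩, hw.pair_empty a haw⟩
    · exact ⟨Or.inr ⟨a, ha, rfl⟩, hw.pair_singleton a haw⟩

theorem num_inter (k : ℕ) : num k ∩ w = num k := by
  ext z
  rw [ZFSet.mem_inter]
  exact and_iff_left_of_imp (hw.trans _ (hw.num_mem k) z)

end PairClosed

end MarshallB2

namespace MarshallB2

open FOFContext Order

open scoped ZFSet

theorem twoClass_vonNeumann {κ : Ordinal.{u}} {x : ZFSet.{u}} :
    TwoClass (V_ κ) x ↔ x.rank < κ + 2 := by
  have h2 : κ + 2 = succ (succ κ) := by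
    rw [succ_eq_add_one, succ_eq_add_one, add_assoc, one_add_one_eq_two]
  rw [h2, lt_succ_iff, ZFSet.rank_le_iff]
  refine forall₂_congr fun y _ => ?_
  rw [lt_succ_iff]
  exact ZFSet.subset_vonNeumann

theorem supertransitive_vonNeumann (κ : Ordinal.{u}) : Supertransitive (V_ κ) where
  trans _ hy _ hz := (ZFSet.isTransitive_vonNeumann κ).mem_trans hz hy
  subset _ hy _ hx :=
    ZFSet.mem_vonNeumann.2 ((ZFSet.rank_mono hx).trans_lt (ZFSet.mem_vonNeumann.1 hy))

theorem pairClosed_vonNeumann {κ : Ordinal.{u}} (hκ : IsSuccLimit κ) : PairClosed (V_ κ) where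
  toSupertransitive := supertransitive_vonNeumann κ
  empty := by
    rw [ZFSet.mem_vonNeumann, ZFSet.rank_empty]
    exact hκ.bot_lt
  pair_empty a ha := by
    simp only [ZFSet.mem_vonNeumann, ZFSet.pair, ZFSet.rank_pair, ZFSet.rank_singleton] at ha ⊢
    have := hκ.bot_lt
    simp only [max_lt_iff, ZFSet.rank_empty, hκ.succ_lt_iff]
    exact ⟨ha, ha, this⟩
  pair_singleton a ha := by
    simp only [ZFSet.mem_vonNeumann, ZFSet.pair, ZFSet.rank_pair, ZFSet.rank_singleton] at ha ⊢
    have := hκ.bot_lt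
    simp only [max_lt_iff, ZFSet.rank_empty, hκ.succ_lt_iff]
    exact ⟨ha, ha, this⟩

/-- The membership relation of the natural structure `V_{κ+2}`. -/
abbrev NatMem (κ : Ordinal.{u}) (x y : {z : ZFSet.{u} // z.rank < κ + 2}) : Prop := x.1 ∈ y.1

theorem isClassB2_natMem_iff {κ : Ordinal.{u}} {x : {z : ZFSet.{u} // z.rank < κ + 2}} :
    IsClassB2 (NatMem κ) x ↔ x.1 ⊆ V_ κ := by
  rw [← isCls_twoClass]
  simp [IsClassB2, IsCls, twoClass_vonNeumann, NatMem]

theorem isSetB2_natMem_iff {κ : Ordinal.{u}} {x : {z : ZFSet.{u} // z.rank < κ + 2}} :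
    IsSetB2 (NatMem κ) x ↔ x.1.rank < κ := by
  rw [← ZFSet.mem_vonNeumann, ← (supertransitive_vonNeumann κ).isSt_iff]
  simp [IsSetB2, IsSt, isClassB2_natMem_iff, isCls_twoClass, twoClass_vonNeumann, NatMem,
    and_left_comm]

theorem rank_le_of_mem_natMem {κ : Ordinal.{u}} {x : ZFSet.{u}}
    {y : {z : ZFSet.{u} // z.rank < κ + 2}} (h : x ∈ y.1) : x.rank ≤ κ :=
  ZFSet.subset_vonNeumann.1 (twoClass_vonNeumann.2 y.2 x h)

theorem kpairB2_natMem_iff {κ : Ordinal.{u}} (hκ : IsSuccLimit κ)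
    {z a t : {z : ZFSet.{u} // z.rank < κ + 2}} (hz : z.1.rank ≤ κ) (ha : a.1.rank < κ)
    (ht : t.1.rank < κ) : KpairB2 (NatMem κ) z a t ↔ z.1 = a.1.pair t.1 := by
  rw [← (pairClosed_vonNeumann hκ).isKpair_iff (ZFSet.subset_vonNeumann.2 hz)
    (ZFSet.mem_vonNeumann.2 ha) (ZFSet.mem_vonNeumann.2 ht)]
  simp [KpairB2, IsKpair, twoClass_vonNeumann, NatMem, Subtype.ext_iff]

theorem emptyB2_natMem_iff {κ : Ordinal.{u}} {t : {z : ZFSet.{u} // z.rank < κ + 2}} :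
    EmptyB2 (NatMem κ) t ↔ t.1 = ∅ := by
  rw [ZFSet.eq_empty]
  exact ⟨fun h y hy => h ⟨y, (ZFSet.rank_lt_of_mem hy).trans t.2⟩ hy, fun h w => h w.1⟩

theorem eq_singleton_iff_natMem {κ : Ordinal.{u}} {t : {z : ZFSet.{u} // z.rank < κ + 2}} :
    (∀ w, NatMem κ w t ↔ EmptyB2 (NatMem κ) w) ↔ t.1 = {∅} := by
  simp only [emptyB2_natMem_iff]
  constructor
  · intro h
    ext y
    rw [ZFSet.mem_singleton]
    refine ⟨fun hy => (h ⟨y, (ZFSet.rank_lt_of_mem hy).trans t.2⟩).1 hy, ?_⟩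
    rintro rfl
    refine (h ⟨∅, ?_⟩).2 rfl
    rw [ZFSet.rank_empty]
    exact lt_of_lt_of_le zero_lt_two (le_add_self)
  · intro h w
    simp [NatMem, h]

theorem eq_cpair_of_cPairI {κ : Ordinal.{u}} (hκ : IsSuccLimit κ)
    {p x y : {z : ZFSet.{u} // z.rank < κ + 2}} (hp : p.1.rank ≤ κ) (hx : x.1.rank ≤ κ)
    (hy : y.1.rank ≤ κ) (h : CPairI (NatMem κ) p x y) : p.1 = cpair x.1 y.1 := by
  have hV := pairClosed_vonNeumann hκ
  rw [← ZFSet.subset_vonNeumann] at hp hx hy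
  have h0 : (∅ : ZFSet.{u}).rank < κ := ZFSet.mem_vonNeumann.1 hV.empty
  have h1 : ({∅} : ZFSet.{u}).rank < κ := ZFSet.mem_vonNeumann.1 (hV.num_mem 1)
  have hlt : ∀ {o : Ordinal.{u}}, o < κ → o < κ + 2 := fun ho => ho.trans_le le_self_add
  ext z
  by_cases hz : z ∈ V_ κ
  swap
  · exact ⟨fun h => absurd (hp h) hz, fun h => absurd (hV.cpair_subset hx hy h) hz⟩
  have hz' := ZFSet.mem_vonNeumann.1 hz
  rw [mem_cpair]
  refine (h ⟨z, hlt hz'⟩).trans (or_congr ?_ ?_)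
  · constructor
    · rintro ⟨a, t, ha, ht, hz⟩
      rw [emptyB2_natMem_iff] at ht
      rw [kpairB2_natMem_iff hκ hz'.le (ZFSet.mem_vonNeumann.1 (hx ha)) (ht ▸ h0)] at hz
      exact ⟨a.1, ha, ht ▸ hz⟩
    · rintro ⟨a, ha, hz⟩
      have ha' := ZFSet.mem_vonNeumann.1 (hx ha)
      exact ⟨⟨a, hlt ha'⟩, ⟨∅, hlt h0⟩, ha, emptyB2_natMem_iff.2 rfl,
        (kpairB2_natMem_iff hκ hz'.le ha' h0).2 hz⟩
  · constructor
    · rintro ⟨a, t, ha, ht, hz⟩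
      rw [eq_singleton_iff_natMem] at ht
      rw [kpairB2_natMem_iff hκ hz'.le (ZFSet.mem_vonNeumann.1 (hy ha)) (ht ▸ h1)] at hz
      exact ⟨a.1, ha, ht ▸ hz⟩
    · rintro ⟨a, ha, hz⟩
      have ha' := ZFSet.mem_vonNeumann.1 (hy ha)
      exact ⟨⟨a, hlt ha'⟩, ⟨{∅}, hlt h1⟩, ha, eq_singleton_iff_natMem.2 rfl,
        (kpairB2_natMem_iff hκ hz'.le ha' h1).2 hz⟩

/-- The reflection schema of a natural model, for 2-classes in the sense of the universe. -/
theorem exists_reflection {κ : Ordinal.{u}} (h : SatB2 (NatMem κ))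
    {P : (ZFSet.{u} → Prop) → ZFSet.{u} → Prop} (hP : Expressible P) {A : ZFSet.{u}}
    (hA : TwoClass (V_ κ) A) (hPA : P (TwoClass (V_ κ)) A) :
    ∃ u w b : ZFSet.{u}, (∀ x ∈ u, x.rank ≤ κ) ∧ (∀ z, z ∈ w ↔ z ∈ u ∧ z.rank < κ) ∧
      w.rank < κ ∧ Supertransitive w ∧
      (IsSuccLimit κ → ∀ x ∈ u, ∀ y ∈ u, cpair x y ∈ u) ∧
      (∀ z, z ∈ b ↔ ∃ x ∈ A, x ∈ u ∧ z = x ∩ w) ∧ P (TwoClass w) b := by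
  obtain ⟨φ, hφ, hφP⟩ := hP
  have hfree : ∀ i ∈ φ.free, i = 0 := fun i hi => Nat.lt_one_iff.1 (hφ hi)
  have hA' := twoClass_vonNeumann.1 hA
  have hE : φ.Eval (NatMem κ) (fun _ => True) (fun _ => ⟨A, hA'⟩) := by
    rw [FOF.eval_map (F := (· ∈ ·)) (D' := TwoClass (V_ κ)) Subtype.val
      (fun x _ => twoClass_vonNeumann.2 x.2)
      (fun y hy => ⟨⟨y, twoClass_vonNeumann.1 hy⟩, trivial, rfl⟩)
      (fun _ _ _ _ => Subtype.ext) (fun _ _ _ _ => Iff.rfl) φ (fun _ => trivial), hφP]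
    exact hPA
  obtain ⟨u, w, b, hw, hwset, hwST, hpair, hb, hbE⟩ := h.2.2.1 φ hfree _ hE
  have hlt : ∀ {o : Ordinal.{u}}, o < κ → o < κ + 2 := fun ho => ho.trans_le le_self_add
  have hM : ∀ (c : {z : ZFSet.{u} // z.rank < κ + 2}) {x}, x ∈ c.1 → x.rank < κ + 2 :=
    fun c _ hx => (ZFSet.rank_lt_of_mem hx).trans c.2
  rw [isSetB2_natMem_iff] at hwset
  have hw' : ∀ z, z ∈ w.1 ↔ z ∈ u.1 ∧ z.rank < κ := by
    intro z
    constructor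
    · intro hz
      simpa [isSetB2_natMem_iff] using (hw ⟨z, hM w hz⟩).1 hz
    · intro hz
      exact (hw ⟨z, hlt hz.2⟩).2 ⟨hz.1, isSetB2_natMem_iff.2 hz.2⟩
  have hwS : Supertransitive w.1 := by
    refine ⟨fun y hy z hz => ?_, fun y hy x hx => ?_⟩
    · have hyM := hM w hy
      exact hwST.1 ⟨y, hyM⟩ hy ⟨z, (ZFSet.rank_lt_of_mem hz).trans hyM⟩ hz
    · have hyM := hM w hy
      exact hwST.2 ⟨y, hyM⟩ hy ⟨x, (ZFSet.rank_mono hx).trans_lt hyM⟩ fun z hz => hx hz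
  have hinter : ∀ x ∈ A, ∀ z, (z ∈ x ∧ z ∈ u.1) ↔ z ∈ x ∩ w.1 := by
    intro x hx z
    rw [ZFSet.mem_inter, hw', and_congr_right_iff]
    exact fun hz => (and_iff_left (ZFSet.mem_vonNeumann.1 (hA x hx z hz))).symm
  have hb' : ∀ z, z ∈ b.1 ↔ ∃ x ∈ A, x ∈ u.1 ∧ z = x ∩ w.1 := by
    intro z
    rcases hb with ⟨hAc, hb⟩ | ⟨-, hb⟩
    · rw [isClassB2_natMem_iff] at hAc
      have key : ∀ x ∈ A, x ∈ u.1 → x ∩ w.1 = x := by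
        intro x hx hxu
        ext y
        rw [ZFSet.mem_inter]
        exact and_iff_left_of_imp
          (hwS.trans x ((hw' x).2 ⟨hxu, ZFSet.mem_vonNeumann.1 (hAc hx)⟩) y)
      constructor
      · intro hz
        obtain ⟨hzA, hzu⟩ := (hb ⟨z, hM b hz⟩).1 hz
        exact ⟨z, hzA, hzu, (key z hzA hzu).symm⟩
      · rintro ⟨x, hxA, hxu, rfl⟩
        rw [key x hxA hxu]
        exact (hb ⟨x, hM u hxu⟩).2 ⟨hxA, hxu⟩
    · constructor
      · intro hz
        obtain ⟨x, hxA, hxu, h⟩ := (hb ⟨z, hM b hz⟩).1 hz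
        refine ⟨x.1, hxA, hxu, ?_⟩
        ext y
        rw [← hinter x.1 hxA]
        constructor
        · exact fun hy => (h ⟨y, (ZFSet.rank_lt_of_mem hy).trans (hM b hz)⟩).1 hy
        · exact fun hy => (h ⟨y, hM u hy.2⟩).2 hy
      · rintro ⟨x, hxA, hxu, rfl⟩
        have hr : (x ∩ w.1).rank < κ + 2 :=
          (ZFSet.rank_mono fun y hy => (ZFSet.mem_inter.1 hy).1).trans_lt (hM u hxu)
        refine (hb ⟨_, hr⟩).2 ⟨⟨x, hM u hxu⟩, hxA, hxu, fun y => ?_⟩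
        exact (hinter x hxA y.1).symm
  have hbw : TwoClass w.1 b.1 := by
    intro y hy z hz
    obtain ⟨x, -, -, rfl⟩ := (hb' y).1 hy
    exact (ZFSet.mem_inter.1 hz).2
  refine ⟨u.1, w.1, b.1, fun x hx => rank_le_of_mem_natMem hx, hw', hwset, hwS, ?_, hb', ?_⟩
  · intro hκ x hx y hy
    obtain ⟨p, hp, hpI⟩ := hpair ⟨x, hM u hx⟩ ⟨y, hM u hy⟩ hx hy
    rw [← eq_cpair_of_cPairI hκ (rank_le_of_mem_natMem hp) (rank_le_of_mem_natMem hx)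
      (rank_le_of_mem_natMem hy) hpI]
    exact hp
  · rw [FOF.eval_congr _ _ φ (σ := fun _ => b)
      (fun i hi => by rw [hfree i hi, Function.update_self])] at hbE
    rw [FOF.eval_map (F := (· ∈ ·)) (D' := TwoClass w.1) Subtype.val ?_ ?_
      (fun _ _ _ _ => Subtype.ext) (fun _ _ _ _ => Iff.rfl) φ ?_, hφP] at hbE
    · exact hbE
    · intro x hx y hy z hz
      have hyM := hM x hy
      exact hx ⟨y, hyM⟩ hy ⟨z, (ZFSet.rank_lt_of_mem hz).trans hyM⟩ hz
    · intro y hy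
      refine ⟨⟨y, twoClass_vonNeumann.1 fun a ha b hb => ?_⟩, fun a ha b hb => hy a.1 ha b.1 hb,
        rfl⟩
      exact ZFSet.mem_vonNeumann.2 ((hw' b).1 (hy a ha b hb)).2
    · exact fun _ a ha c hc => hbw a.1 ha c.1 hc

theorem isSuccLimit_of_satB2 {κ : Ordinal.{u}} (h : SatB2 (NatMem κ)) (h0 : κ ≠ 0) :
    IsSuccLimit κ := by
  rcases Ordinal.zero_or_succ_or_isSuccLimit κ with rfl | ⟨o, rfl⟩ | hκ
  · exact absurd rfl h0
  · exfalso
    have hV := supertransitive_vonNeumann (succ o)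
    have ho : V_ o ∈ V_ (succ o) := by
      rw [ZFSet.mem_vonNeumann, ZFSet.rank_vonNeumann]
      exact lt_succ o
    obtain ⟨u, w, b, -, hw, hwr, hwS, -, hb, hP⟩ := exists_reflection h
      (expressible_isSt isVar_id) (hV.twoClass_of_mem ho) (hV.isSt_iff.2 ho)
    rw [hwS.isSt_iff] at hP
    refine ZFSet.mem_irrefl b ((hb b).2 ⟨b, ?_, ((hw b).1 hP).1, ?_⟩)
    · exact ZFSet.mem_vonNeumann.2 ((ZFSet.rank_lt_of_mem hP).trans_le (lt_succ_iff.1 hwr))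
    · ext y
      rw [ZFSet.mem_inter]
      exact (and_iff_left_of_imp (hwS.trans b hP y)).symm
  · exact hκ

end MarshallB2

namespace MarshallB2

open FOFContext Order

open scoped ZFSet

theorem rank_cpair_lt {κ : Ordinal.{u}} (hκ : IsSuccLimit κ) {x y : ZFSet.{u}} (hx : x.rank < κ)
    (hy : y.rank < κ) : (cpair x y).rank < κ := by
  have h2 : (2 : Ordinal.{u}) < κ := by
    rw [← one_add_one_eq_two, ← succ_eq_add_one, hκ.succ_lt_iff]
    simpa using hκ.succ_lt hκ.bot_lt
  set o := max x.rank (max y.rank 2)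
  have hpair : ∀ a t : ZFSet.{u}, a.rank < o → t.rank < o → (a.pair t).rank < succ (succ o) := by
    intro a t ha ht
    simp only [ZFSet.pair, ZFSet.rank_pair, ZFSet.rank_singleton, succ_lt_succ_iff, max_lt_iff,
      ha, ht, and_self]
  have h2o : 2 ≤ o := (le_max_right _ _).trans (le_max_right _ _)
  refine lt_of_le_of_lt ?_ (hκ.succ_lt (hκ.succ_lt (max_lt hx (max_lt hy h2))))
  rw [ZFSet.rank_le_iff]
  intro z hz
  rcases mem_cpair.1 hz with ⟨a, ha, rfl⟩ | ⟨a, ha, rfl⟩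
  · refine hpair _ _ ((ZFSet.rank_lt_of_mem ha).trans_le (le_max_left _ _)) (lt_of_lt_of_le ?_ h2o)
    rw [ZFSet.rank_empty]
    exact zero_lt_two
  · refine hpair _ _ ((ZFSet.rank_lt_of_mem ha).trans_le
      ((le_max_left _ _).trans (le_max_right _ _))) (lt_of_lt_of_le ?_ h2o)
    rw [ZFSet.rank_singleton, ZFSet.rank_empty, succ_eq_add_one, zero_add]
    exact one_lt_two

/-- The entries, tagged by numbers, of the 2-class that codes the family of predicates `Q` on
the classes over `v`. -/
def Entry (v : ZFSet.{u}) (Q : ℕ → ZFSet.{u} → Prop) : ℕ → ZFSet.{u} → Prop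
  | 0, t => ∃ n s, t = cpair (num n) s ∧ Q n s
  | 1, _ => True
  | 2, t => ∃ n s, t = cpair (num n) s ∧ ¬ Q n s
  | 3, t => ∃ n s, t = cpair (num n) s ∧ ∃ x ⊆ v, Q n (cpair (cpair (num 1) x) s)
  | _, _ => False

/-- The 2-class that codes the family of predicates `Q` on the classes over `v`. -/
noncomputable def predicateCode (v : ZFSet.{u}) (Q : ℕ → ZFSet.{u} → Prop) : ZFSet.{u} :=
  v.powerset.sep fun z => ∃ k t, z = cpair (num k) t ∧ Entry v Q k t

theorem subset_of_mem_predicateCode {v : ZFSet.{u}} {Q : ℕ → ZFSet.{u} → Prop} {z : ZFSet.{u}}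
    (hz : z ∈ predicateCode v Q) : z ⊆ v :=
  ZFSet.mem_powerset.1 (ZFSet.mem_sep.1 hz).1

theorem mem_predicateCode {v : ZFSet.{u}} {Q : ℕ → ZFSet.{u} → Prop} {k : ℕ} {t : ZFSet.{u}} :
    cpair (num k) t ∈ predicateCode v Q ↔ cpair (num k) t ⊆ v ∧ Entry v Q k t := by
  rw [predicateCode, ZFSet.mem_sep, ZFSet.mem_powerset]
  refine and_congr_right fun _ => ⟨?_, fun h => ⟨k, t, rfl, h⟩⟩
  rintro ⟨l, t', h, hl⟩
  obtain ⟨hkl, rfl⟩ := cpair_inj.1 h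
  rwa [num_injective hkl]

theorem PairClosed.num_subset {w : ZFSet.{u}} (hw : PairClosed w) (k : ℕ) : num k ⊆ w :=
  hw.trans _ (hw.num_mem k)

theorem PairClosed.of_setsClosed {κ : Ordinal.{u}} (hκ : IsSuccLimit κ) {u w : ZFSet.{u}}
    (hw : Supertransitive w) (hwu : ∀ z, z ∈ w ↔ z ∈ u ∧ z.rank < κ)
    (hu : ∀ x ∈ u, ∀ y ∈ u, cpair x y ∈ u) (h : SetsClosed (TwoClass w)) : PairClosed w := by
  obtain ⟨⟨x, hx⟩, h⟩ := hw.setsClosed_iff.1 h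
  have h0 : ∅ ∈ w := hw.subset x hx ∅ (ZFSet.empty_subset x)
  have hpair : ∀ x ∈ w, ∀ y ∈ w, cpair x y ∈ w := by
    intro x hx y hy
    rw [hwu] at hx hy ⊢
    exact ⟨hu x hx.1 y hy.1, rank_cpair_lt hκ hx.2 hy.2⟩
  refine ⟨hw, h0, fun a ha => ?_, fun a ha => ?_⟩
  · obtain ⟨y, hy, hay, -⟩ := h a ha
    exact hw.trans _ (hpair y hy ∅ h0) _ (pair_empty_mem_cpair.2 hay)
  · obtain ⟨y, hy, hay, -⟩ := h a ha
    exact hw.trans _ (hpair ∅ h0 y hy) _ (pair_singleton_mem_cpair.2 hay)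

theorem setsClosed_vonNeumann {κ : Ordinal.{u}} (hκ : IsSuccLimit κ) :
    SetsClosed (TwoClass (V_ κ)) := by
  refine (supertransitive_vonNeumann κ).setsClosed_iff.2
    ⟨⟨∅, (pairClosed_vonNeumann hκ).empty⟩, fun x hx => ⟨V_ (succ x.rank), ?_, ?_, ?_⟩⟩
  · rw [ZFSet.mem_vonNeumann] at hx ⊢
    rw [ZFSet.rank_vonNeumann]
    exact hκ.succ_lt hx
  · rw [ZFSet.mem_vonNeumann]
    exact lt_succ _
  · intro a ha b hb
    rw [ZFSet.mem_vonNeumann]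
    exact ((ZFSet.rank_lt_of_mem hb).trans (ZFSet.rank_lt_of_mem ha)).trans (lt_succ _)

theorem codesPredicates_predicateCode {w : ZFSet.{u}} (hw : PairClosed w)
    (Q : ℕ → ZFSet.{u} → Prop) : CodesPredicates (TwoClass w) (predicateCode w Q) := by
  have hA : TwoClass w (predicateCode w Q) := fun y hy => subset_of_mem_predicateCode hy
  refine (hw.codesPredicates_iff hA).2 ⟨?_, ?_, ?_⟩
  · rintro c - s - ⟨h0, h2⟩
    obtain ⟨-, n, s', h, hQ⟩ := mem_predicateCode.1 h0
    obtain ⟨-, n', s'', h', hQ'⟩ := mem_predicateCode.1 h2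
    obtain ⟨rfl, rfl⟩ := cpair_inj.1 h
    obtain ⟨hn, rfl⟩ := cpair_inj.1 h'
    rw [num_injective hn] at hQ
    exact hQ' hQ
  · intro c hc s hs h3
    obtain ⟨-, n, s', h, x, hx, hQ⟩ := mem_predicateCode.1 h3
    obtain ⟨rfl, rfl⟩ := cpair_inj.1 h
    have he := hw.cpair_subset (hw.num_subset 1) hx
    refine ⟨_, mem_predicateCode.2 ⟨he, trivial⟩, mem_predicateCode.2 ⟨?_, n, _, rfl, hQ⟩⟩
    exact hw.cpair_subset (hw.num_subset 0) (hw.cpair_subset hc (hw.cpair_subset he hs))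
  · exact fun x hx => mem_predicateCode.2 ⟨hw.cpair_subset (hw.num_subset 1) hx, trivial⟩

/-- A reflecting set for a family of predicates `Q` on the classes over `V_κ`. -/
structure Reflecting (κ : Ordinal.{u}) (Q : ℕ → ZFSet.{u} → Prop) (u w : ZFSet.{u}) : Prop where
  rank_le : ∀ x ∈ u, x.rank ≤ κ
  mem_iff : ∀ z, z ∈ w ↔ z ∈ u ∧ z.rank < κ
  rank_lt : w.rank < κ
  pairClosed : PairClosed w
  union : ∀ x ∈ w, ∃ y ∈ w, x ∈ y ∧ ∀ a ∈ x, ∀ b ∈ a, b ∈ y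
  cpair_mem : ∀ x ∈ u, ∀ y ∈ u, cpair x y ∈ u
  trace : ∀ x ⊆ w, ∃ y, cpair (num 1) y ∈ u ∧ y ∩ w = x
  witness : ∀ n, ∀ s ∈ u, (∃ x, x.rank ≤ κ ∧ Q n (cpair (cpair (num 1) x) s)) →
    ∃ e ∈ u, Q n (cpair e s)

theorem exists_reflecting {κ : Ordinal.{u}} (h : SatB2 (NatMem κ)) (hκ : IsSuccLimit κ)
    (Q : ℕ → ZFSet.{u} → Prop) : ∃ u w, Reflecting κ Q u w := by
  have hV := pairClosed_vonNeumann hκ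
  set A := predicateCode (V_ κ) Q
  have hA : TwoClass (V_ κ) A := fun y hy => subset_of_mem_predicateCode hy
  obtain ⟨u, w, b, hu, hwu, hwr, hwS, hcp, hb, hsc, hcode⟩ := exists_reflection h
    (P := fun D x => SetsClosed D ∧ CodesPredicates D x)
    (expressible_setsClosed.and (expressible_codesPredicates isVar_id)) hA
    ⟨setsClosed_vonNeumann hκ, codesPredicates_predicateCode hV Q⟩
  have hcp := hcp hκ
  have hw : PairClosed w := .of_setsClosed hκ hwS hwu hcp hsc
  have hbw : TwoClass w b := by
    intro y hy z hz
    obtain ⟨x, -, -, rfl⟩ := (hb y).1 hy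
    exact (ZFSet.mem_inter.1 hz).2
  obtain ⟨hdisj, hex, hall⟩ := (hw.codesPredicates_iff hbw).1 hcode
  have hnum : ∀ k, num k ∈ u := fun k => ((hwu _).1 (hw.num_mem k)).1
  have hsub : ∀ x ∈ u, x ⊆ V_ κ := fun x hx => ZFSet.subset_vonNeumann.2 (hu x hx)
  have hentry : ∀ k n, ∀ s ∈ u, Entry (V_ κ) Q k (cpair (num n) s) →
      cpair (num k) (cpair (num n) (s ∩ w)) ∈ b := by
    intro k n s hs hE
    have hmem := hcp _ (hnum k) _ (hcp _ (hnum n) _ hs)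
    refine (hb _).2 ⟨_, mem_predicateCode.2 ⟨hsub _ hmem, hE⟩, hmem, ?_⟩
    rw [hw.cpair_inter, hw.cpair_inter, hw.num_inter, hw.num_inter]
  have hinter : ∀ x, x ∩ w ⊆ w := fun x z hz => (ZFSet.mem_inter.1 hz).2
  refine ⟨u, w, hu, hwu, hwr, hw, (hwS.setsClosed_iff.1 hsc).2, hcp, ?_, ?_⟩
  · intro x hx
    obtain ⟨p, hpA, hpu, hp⟩ := (hb _).1 (hall x hx)
    obtain ⟨-, k, t, rfl, -⟩ := ZFSet.mem_sep.1 hpA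
    rw [hw.cpair_inter, hw.num_inter, cpair_inj] at hp
    exact ⟨t, by rwa [hp.1], hp.2.symm⟩
  · rintro n s hs ⟨x, hx, hQ⟩
    obtain ⟨e', he', h0⟩ := hex _ (hw.num_subset n) _ (hinter s)
      (hentry 3 n s hs ⟨n, s, rfl, x, ZFSet.subset_vonNeumann.2 hx, hQ⟩)
    obtain ⟨e, -, he, rfl⟩ := (hb _).1 he'
    refine ⟨e, he, by_contra fun hn => ?_⟩
    have h2 := hentry 2 n _ (hcp e he s hs) ⟨n, _, rfl, hn⟩
    rw [hw.cpair_inter] at h2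
    exact hdisj _ (hw.num_subset n) _ (hw.cpair_subset (hinter e) (hinter s)) ⟨h0, h2⟩

end MarshallB2

instance : Countable FOF := FOF.code_injective.countable

namespace MarshallB2

open Order

open scoped ZFSet

theorem rank_le_rank_cpair (x y : ZFSet.{u}) : y.rank ≤ (cpair x y).rank := by
  rw [ZFSet.rank_le_iff]
  intro a ha
  have h1 : a ∈ ({a} : ZFSet.{u}) := ZFSet.mem_singleton.2 rfl
  have h2 : {a} ∈ a.pair {∅} := by simp [ZFSet.pair]
  exact (ZFSet.rank_lt_of_mem h1).trans ((ZFSet.rank_lt_of_mem h2).trans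
    (ZFSet.rank_lt_of_mem (pair_singleton_mem_cpair.2 ha)))

theorem PairClosed.mem_of_cpair_mem {w : ZFSet.{u}} (hw : PairClosed w)
    (hU : ∀ x ∈ w, ∃ y ∈ w, x ∈ y ∧ ∀ a ∈ x, ∀ b ∈ a, b ∈ y) {x y : ZFSet.{u}}
    (h : cpair x y ∈ w) : y ∈ w := by
  obtain ⟨y₀, h₀, -, hy₀⟩ := hU _ h
  obtain ⟨y₁, h₁, -, hy₁⟩ := hU _ h₀
  refine hw.subset y₁ h₁ y fun a ha => hy₁ {a} ?_ a (ZFSet.mem_singleton.2 rfl)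
  exact hy₀ _ (pair_singleton_mem_cpair.2 ha) _ (by simp [ZFSet.pair])

theorem vonNeumann_rank_eq {w : ZFSet.{u}} (htrans : ∀ y ∈ w, ∀ z ∈ y, z ∈ w)
    (h : ∀ z ∈ w, ∃ ξ, V_ ξ ∈ w ∧ z ∈ V_ ξ) : w = V_ w.rank := by
  ext z
  rw [ZFSet.mem_vonNeumann]
  refine ⟨ZFSet.rank_lt_of_mem, fun hz => ?_⟩
  obtain ⟨y, hy, hzy⟩ := ZFSet.lt_rank_iff.1 hz
  obtain ⟨ξ, hξ, hyξ⟩ := h y hy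
  exact htrans _ hξ z (ZFSet.mem_vonNeumann.2 (hzy.trans_lt (ZFSet.mem_vonNeumann.1 hyξ)))

/-- A class coding a finite list of classes. -/
noncomputable def encList : List ZFSet.{u} → ZFSet.{u}
  | [] => ∅
  | x :: l => cpair (cpair (num 1) x) (encList l)

theorem cpair_cpair_num_one_ne_empty (x y : ZFSet.{u}) : cpair (cpair (num 1) x) y ≠ ∅ := by
  intro h
  have h1 : ∅ ∈ num.{u} 1 := ZFSet.mem_singleton.2 rfl
  have h2 := (pair_empty_mem_cpair (y := y)).2 ((pair_empty_mem_cpair (y := x)).2 h1)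
  exact ZFSet.notMem_empty _ (h ▸ h2)

theorem encList_injective : Function.Injective encList.{u} := by
  intro l
  induction l with
  | nil =>
    rintro (_ | ⟨y, m⟩) h
    · rfl
    · exact absurd h.symm (cpair_cpair_num_one_ne_empty _ _)
  | cons x l ih =>
    rintro (_ | ⟨y, m⟩) h
    · exact absurd h (cpair_cpair_num_one_ne_empty _ _)
    · obtain ⟨h1, h2⟩ := cpair_inj.1 h
      rw [(cpair_inj.1 h1).2, ih h2]

/-- A collection of classes over `V_κ` whose traces on `V_β` are all the classes over `V_β`. -/
structure Reflects (κ β : Ordinal.{u}) (U : Set ZFSet.{u}) : Prop where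
  rank_le : ∀ x ∈ U, x.rank ≤ κ
  mem_of_rank_lt : ∀ x, x.rank < β → x ∈ U
  rank_lt : ∀ x ∈ U, x.rank < κ → x.rank < β
  trace : ∀ x ⊆ V_ β, ∃ y ∈ U, y ∩ V_ β = x

theorem exists_reflects {κ : Ordinal.{u}} (h : SatB2 (NatMem κ)) (hκ : IsSuccLimit κ)
    {γ : Ordinal.{u}} (hγ : γ < κ) {ι : Type} [Countable ι] (R : ι → List ZFSet.{u} → Prop) :
    ∃ β U, γ < β ∧ β < κ ∧ Reflects κ β U ∧ ∀ i l, (∀ x ∈ l, x ∈ U) →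
      (∃ x, x.rank ≤ κ ∧ R i (x :: l)) → ∃ x ∈ U, R i (x :: l) := by
  let R' : Option ι → List ZFSet.{u} → Prop
    | none, l => ∃ ξ z, γ ≤ ξ ∧ ξ < κ ∧ z ∈ V_ ξ ∧ l = [V_ ξ, z]
    | some i, l => R i l
  obtain ⟨f, hf⟩ := exists_injective_nat (Option ι)
  obtain ⟨u, w, H⟩ := exists_reflecting h hκ
    (fun n t => ∃ i x l, f i = n ∧ t = encList (x :: l) ∧ R' i (x :: l))
  have hw := H.pairClosed
  have hwu : ∀ x ∈ w, x ∈ u := fun x hx => ((H.mem_iff x).1 hx).1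
  set U : Set ZFSet.{u} := {x | cpair (num 1) x ∈ u}
  have hlist : ∀ l, (∀ x ∈ l, x ∈ U) → encList l ∈ u := by
    intro l
    induction l with
    | nil => exact fun _ => hwu _ hw.empty
    | cons x l ih =>
      intro hl
      exact H.cpair_mem _ (hl x (by simp)) _ (ih fun y hy => hl y (by simp [hy]))
  have hwit : ∀ i l, (∀ x ∈ l, x ∈ U) → (∃ x, x.rank ≤ κ ∧ R' i (x :: l)) →
      ∃ x ∈ U, R' i (x :: l) := by
    rintro i l hl ⟨x, hx, hR⟩
    obtain ⟨e, he, i', y, m, hi, hl', hR'⟩ := H.witness (f i) (encList l) (hlist l hl)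
      ⟨x, hx, i, x, l, rfl, rfl, hR⟩
    obtain rfl := hf hi
    obtain ⟨rfl, hm⟩ := cpair_inj.1 hl'
    obtain rfl := encList_injective hm
    exact ⟨y, he, hR'⟩
  have hUw : ∀ x ∈ U, x.rank < κ → x ∈ w := fun x hx hxκ =>
    hw.mem_of_cpair_mem H.union ((H.mem_iff _).2 ⟨hx, rank_cpair_lt hκ
      ((H.mem_iff _).1 (hw.num_mem 1)).2 hxκ⟩)
  have hwU : ∀ x ∈ w, x ∈ U := fun x hx => H.cpair_mem _ (hwu _ (hw.num_mem 1)) _ (hwu x hx)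
  have hV : ∀ z ∈ w, ∃ ξ, γ ≤ ξ ∧ V_ ξ ∈ w ∧ z ∈ V_ ξ := by
    intro z hz
    have hzκ := ((H.mem_iff z).1 hz).2
    have hmax := max_lt hγ (hκ.succ_lt hzκ)
    obtain ⟨x, hx, ξ, z', hγξ, hξ, hzξ, hxz⟩ := hwit none [z] (by simpa using hwU z hz)
      ⟨V_ (max γ (succ z.rank)), by rw [ZFSet.rank_vonNeumann]; exact hmax.le, _, z,
        le_max_left _ _, hmax, ZFSet.mem_vonNeumann.2 (lt_max_of_lt_right (lt_succ _)), rfl⟩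
    simp only [List.cons.injEq, and_true] at hxz
    obtain ⟨rfl, rfl⟩ := hxz
    exact ⟨ξ, hγξ, hUw _ hx (by rwa [ZFSet.rank_vonNeumann]), hzξ⟩
  have hwV := vonNeumann_rank_eq hw.trans fun z hz => (hV z hz).imp fun _ => And.right
  refine ⟨w.rank, U, ?_, H.rank_lt, ⟨fun x hx => ?_, fun x hx => ?_, fun x hx hxκ => ?_, ?_⟩,
    fun i l hl hx => hwit (some i) l hl hx⟩
  · obtain ⟨ξ, hγξ, hξ, -⟩ := hV _ hw.empty
    have := ZFSet.rank_lt_of_mem hξ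
    rw [ZFSet.rank_vonNeumann] at this
    exact hγξ.trans_lt this
  · exact (rank_le_rank_cpair _ _).trans (H.rank_le _ hx)
  · exact hwU x (hwV ▸ ZFSet.mem_vonNeumann.2 hx)
  · exact ZFSet.rank_lt_of_mem (hUw x hx hxκ)
  · rw [← hwV]
    exact H.trace

end MarshallB2

namespace MarshallB2

open Order

open scoped ZFSet

theorem mem_Vset_add_one {α : Ordinal.{u}} {x : ZFSet.{u}} :
    x ∈ Vset (α + (1 : ℕ)) ↔ x.rank ≤ α := by
  rw [Nat.cast_one, ← succ_eq_add_one]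
  exact lt_succ_iff (b := α)

theorem exists_elementary_reflects {κ : Ordinal.{u}} (h : SatB2 (NatMem κ)) (hκ : IsSuccLimit κ)
    {γ : Ordinal.{u}} (hγ : γ < κ) {ι : Type} [Countable ι] (R : ι → List ZFSet.{u} → Prop) :
    ∃ β U, γ < β ∧ β < κ ∧ Reflects κ β U ∧
      (∀ φ : FOF, ∀ ρ : ℕ → ZFSet.{u}, (∀ i, ρ i ∈ U) →
        (φ.Eval (· ∈ ·) (· ∈ U) ρ ↔ φ.Eval (· ∈ ·) (· ∈ Vset (κ + (1 : ℕ))) ρ)) ∧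
      ∀ i l, (∀ x ∈ l, x ∈ U) → (∃ x, x.rank ≤ κ ∧ R i (x :: l)) → ∃ x ∈ U, R i (x :: l) := by
  let R' : (FOF × ℕ) ⊕ ι → List ZFSet.{u} → Prop
    | .inl (φ, i), x :: l => φ.Eval (· ∈ ·) (· ∈ Vset (κ + (1 : ℕ)))
        (Function.update (fun k => l.getD k ∅) i x)
    | .inl _, [] => False
    | .inr i, l => R i l
  obtain ⟨β, U, hγβ, hβκ, hU, hwit⟩ := exists_reflects h hκ hγ R'
  refine ⟨β, U, hγβ, hβκ, hU, fun φ ρ hρ => ?_, fun i l hl hx => hwit (.inr i) l hl hx⟩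
  refine FOF.eval_iff_of_tarskiVaught (fun x hx => mem_Vset_add_one.2 (hU.rank_le x hx)) ?_ φ hρ
  intro φ i ρ hρ hx
  obtain ⟨n, hn⟩ := φ.exists_free_subset_Iio
  have hev : ∀ x, φ.Eval (· ∈ ·) (· ∈ Vset (κ + (1 : ℕ))) (Function.update ρ i x) ↔
      R' (.inl (φ, i)) (x :: (List.range n).map ρ) := by
    intro x
    refine FOF.eval_congr _ _ φ fun k hk => ?_
    by_cases hki : k = i
    · rw [hki, Function.update_self, Function.update_self]
    · have hkn : k < n := hn hk
      simp [Function.update_of_ne hki, hkn]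
  simp only [hev] at hx ⊢
  refine hwit (.inl (φ, i)) _ ?_ (hx.imp fun x hx => ⟨mem_Vset_add_one.1 hx.1, hx.2⟩)
  intro x hx
  obtain ⟨k, -, rfl⟩ := List.mem_map.1 hx
  exact hρ k

theorem inter_vonNeumann_eq_self {β : Ordinal.{u}} {x : ZFSet.{u}} (hx : x.rank ≤ β) :
    x ∩ V_ β = x := by
  ext z
  rw [ZFSet.mem_inter]
  exact and_iff_left_of_imp (ZFSet.subset_vonNeumann.2 hx ·)

theorem toZFSet_inter_vonNeumann {κ β : Ordinal.{u}} (hβκ : β ≤ κ) :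
    κ.toZFSet ∩ V_ β = β.toZFSet := by
  ext z
  rw [ZFSet.mem_inter, Ordinal.mem_toZFSet_iff, Ordinal.mem_toZFSet_iff, ZFSet.mem_vonNeumann]
  constructor
  · rintro ⟨⟨o, -, rfl⟩, ho⟩
    exact ⟨o, by rwa [Ordinal.rank_toZFSet] at ho, rfl⟩
  · rintro ⟨o, ho, rfl⟩
    exact ⟨⟨o, lt_of_lt_of_le ho hβκ, rfl⟩, by rwa [Ordinal.rank_toZFSet]⟩

namespace Reflects

variable {κ β : Ordinal.{u}} {U : Set ZFSet.{u}} (hU : Reflects κ β U)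
  (hel : ∀ φ : FOF, ∀ ρ : ℕ → ZFSet.{u}, (∀ i, ρ i ∈ U) →
    (φ.Eval (· ∈ ·) (· ∈ U) ρ ↔ φ.Eval (· ∈ ·) (· ∈ Vset (κ + (1 : ℕ))) ρ))

include hU hel

theorem subset_of_inter_eq {x y : ZFSet.{u}} (hx : x ∈ U) (hy : y ∈ U)
    (h : x ∩ V_ β = y ∩ V_ β) : x ⊆ y := by
  intro z hz
  by_contra hzy
  have hzx := (ZFSet.rank_lt_of_mem hz).trans_le (hU.rank_le x hx)
  let ρ : ℕ → ZFSet.{u} := fun k => if k = 0 then x else y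
  have hρ : ∀ i, ρ i ∈ U := by
    intro i
    by_cases hi : i = 0 <;> simp [ρ, hi, hx, hy]
  obtain ⟨z', hz'U, hz'x, hz'y⟩ := (hel (.ex 2 (.and (.mem 2 0) (.not (.mem 2 1)))) ρ hρ).2
    ⟨z, mem_Vset_add_one.2 hzx.le, by simp [FOF.Eval, ρ, hz, hzy]⟩
  simp only [FOF.Eval, ρ, Function.update_self, ne_eq, OfNat.zero_ne_ofNat, OfNat.one_ne_ofNat,
    not_false_eq_true, Function.update_of_ne, if_true, one_ne_zero, if_false] at hz'x hz'y
  have hz'β := hU.rank_lt z' hz'U ((ZFSet.rank_lt_of_mem hz'x).trans_le (hU.rank_le x hx))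
  have : z' ∈ y ∩ V_ β := h ▸ ZFSet.mem_inter.2 ⟨hz'x, ZFSet.mem_vonNeumann.2 hz'β⟩
  exact hz'y (ZFSet.mem_inter.1 this).1

theorem inter_inj {x y : ZFSet.{u}} (hx : x ∈ U) (hy : y ∈ U) (h : x ∩ V_ β = y ∩ V_ β) : x = y :=
  le_antisymm (hU.subset_of_inter_eq hel hx hy h) (hU.subset_of_inter_eq hel hy hx h.symm)

theorem mem_iff_inter_mem_inter {x y : ZFSet.{u}} (hx : x ∈ U) (hy : y ∈ U) :
    x ∈ y ↔ x ∩ V_ β ∈ y ∩ V_ β := by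
  rw [ZFSet.mem_inter, ZFSet.mem_vonNeumann]
  constructor
  · intro h
    have hxβ := hU.rank_lt x hx ((ZFSet.rank_lt_of_mem h).trans_le (hU.rank_le y hy))
    rw [inter_vonNeumann_eq_self hxβ.le]
    exact ⟨h, hxβ⟩
  · rintro ⟨h, hxβ⟩
    rwa [hU.inter_inj hel hx (hU.mem_of_rank_lt _ hxβ) (inter_vonNeumann_eq_self hxβ.le).symm]

theorem eval_inter_iff (φ : FOF) {ρ : ℕ → ZFSet.{u}} (hρ : ∀ i, ρ i ∈ U) :
    φ.Eval (· ∈ ·) (· ∈ Vset (κ + (1 : ℕ))) ρ ↔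
      φ.Eval (· ∈ ·) (· ∈ Vset (β + (1 : ℕ))) (fun i => ρ i ∩ V_ β) := by
  rw [← hel φ ρ hρ]
  refine FOF.eval_map (E := (· ∈ ·)) (F := (· ∈ ·)) (· ∩ V_ β) (fun x _ => mem_Vset_add_one.2 ?_) ?_
    (fun x y hx hy => hU.inter_inj hel hx hy)
    (fun x y hx hy => hU.mem_iff_inter_mem_inter hel hx hy) φ hρ
  · exact ZFSet.subset_vonNeumann.1 fun z hz => (ZFSet.mem_inter.1 hz).2
  · exact fun y hy => hU.trace y (ZFSet.subset_vonNeumann.2 (mem_Vset_add_one.1 hy))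

theorem nExtendibleTo_self (hβκ : β < κ) (hκU : κ.toZFSet ∈ U) : NExtendibleTo 1 β κ := by
  have : ∀ x : ZFSet.{u}, ∃ y, x.rank ≤ β → y ∈ U ∧ y ∩ V_ β = x := by
    intro x
    by_cases hx : x.rank ≤ β
    · obtain ⟨y, hy⟩ := hU.trace x (ZFSet.subset_vonNeumann.2 hx)
      exact ⟨y, fun _ => hy⟩
    · exact ⟨∅, fun h => absurd h hx⟩
  choose j hj using this
  refine ⟨hβκ, j, fun x hx => ?_, fun φ ρ hρ => ?_, fun x _ hxβ => ?_, fun x hxo hxβ => ?_⟩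
  · exact mem_Vset_add_one.2 (hU.rank_le _ (hj x (mem_Vset_add_one.1 hx)).1)
  · have hρ' := fun i => hj (ρ i) (mem_Vset_add_one.1 (hρ i))
    rw [hU.eval_inter_iff hel φ fun i => (hρ' i).1]
    simp only [fun i => (hρ' i).2]
  · obtain ⟨h1, h2⟩ := hj x hxβ.le
    exact hU.inter_inj hel h1 (hU.mem_of_rank_lt x hxβ)
      (h2.trans (inter_vonNeumann_eq_self hxβ.le).symm)
  · obtain ⟨h1, h2⟩ := hj x hxβ.le
    have : j x = κ.toZFSet := by
      refine hU.inter_inj hel h1 hκU ?_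
      rw [h2, toZFSet_inter_vonNeumann hβκ.le, ← hxβ, hxo.toZFSet_rank_eq]
    rw [this]
    exact ⟨ZFSet.isOrdinal_toZFSet κ, Ordinal.rank_toZFSet κ⟩

theorem nExtendibleTo_of_mem {α : Ordinal.{u}} (hαβ : α < β) (hβκ : β < κ)
    {j : ZFSet.{u} → ZFSet.{u}}
    (hj : ∀ (φ : FOF) (ρ : ℕ → ZFSet.{u}), (∀ i, ρ i ∈ Vset (α + (1 : ℕ))) →
      (φ.Eval (· ∈ ·) (· ∈ Vset (α + (1 : ℕ))) ρ ↔
        φ.Eval (· ∈ ·) (· ∈ Vset (κ + (1 : ℕ))) (fun i => j (ρ i))))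
    (hfix : ∀ x : ZFSet.{u}, x.IsOrdinal → x.rank < α → j x = x)
    (hcrit : ∀ x : ZFSet.{u}, x.IsOrdinal → x.rank = α → (j x).IsOrdinal ∧ (j x).rank = κ)
    (hjU : ∀ x, x.rank ≤ α → j x ∈ U) : NExtendibleTo 1 α β := by
  refine ⟨hαβ, fun x => j x ∩ V_ β, fun x _ => mem_Vset_add_one.2 ?_, fun φ ρ hρ => ?_,
    fun x hxo hxα => ?_, fun x hxo hxα => ?_⟩
  · exact ZFSet.subset_vonNeumann.1 fun z hz => (ZFSet.mem_inter.1 hz).2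
  · rw [hj φ ρ hρ, hU.eval_inter_iff hel φ fun i => hjU _ (mem_Vset_add_one.1 (hρ i))]
  · change j x ∩ V_ β = x
    rw [hfix x hxo hxα, inter_vonNeumann_eq_self (hxα.trans hαβ).le]
  · obtain ⟨h1, h2⟩ := hcrit x hxo hxα
    have hjx : j x ∩ V_ β = β.toZFSet := by
      rw [← toZFSet_inter_vonNeumann hβκ.le, ← h2, h1.toZFSet_rank_eq]
    change (j x ∩ V_ β).IsOrdinal ∧ (j x ∩ V_ β).rank = β
    rw [hjx]
    exact ⟨ZFSet.isOrdinal_toZFSet β, Ordinal.rank_toZFSet β⟩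

end Reflects

/-- The `1`-extendible chains below `κ` all of whose elements are `1`-extendible to `κ`. -/
def IsChainBelow (κ : Ordinal.{u}) (S : Set Ordinal.{u}) : Prop :=
  S ⊆ Set.Iio κ ∧ ∀ α ∈ S, ∀ β, α < β → (β ∈ S ∨ β = κ) → NExtendibleTo 1 α β

theorem IsChainBelow.exists_insert {κ : Ordinal.{u}} (h : SatB2 (NatMem κ)) (hκ : IsSuccLimit κ)
    {S : Set Ordinal.{u}} (hS : IsChainBelow κ S) {γ : Ordinal.{u}} (hγ : γ < κ)
    (hSγ : ∀ α ∈ S, α < γ) : ∃ β, γ < β ∧ IsChainBelow κ (insert β S) := by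
  have hemb : ∀ α : Ordinal.{u}, ∃ j : ZFSet.{u} → ZFSet.{u}, α ∈ S →
      (∀ x, x ∈ Vset (α + (1 : ℕ)) → j x ∈ Vset (κ + (1 : ℕ))) ∧
      (∀ (φ : FOF) (ρ : ℕ → ZFSet.{u}), (∀ i, ρ i ∈ Vset (α + (1 : ℕ))) →
        (φ.Eval (· ∈ ·) (· ∈ Vset (α + (1 : ℕ))) ρ ↔
          φ.Eval (· ∈ ·) (· ∈ Vset (κ + (1 : ℕ))) (fun i => j (ρ i)))) ∧
      (∀ x : ZFSet.{u}, x.IsOrdinal → x.rank < α → j x = x) ∧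
      (∀ x : ZFSet.{u}, x.IsOrdinal → x.rank = α → (j x).IsOrdinal ∧ (j x).rank = κ) := by
    intro α
    by_cases hα : α ∈ S
    · obtain ⟨-, j, hj⟩ := hS.2 α hα κ (hS.1 hα) (Or.inr rfl)
      exact ⟨j, fun _ => hj⟩
    · exact ⟨id, fun h => absurd h hα⟩
  choose j hj using hemb
  obtain ⟨β, U, hγβ, hβκ, hU, hel, hwit⟩ := exists_elementary_reflects h hκ hγ
    (fun (b : Bool) l => if b then l = [κ.toZFSet] else
      ∃ α x, l = [j α x, V_ α, x])
  have hκU : κ.toZFSet ∈ U := by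
    obtain ⟨x, hx, hxκ⟩ := hwit true [] (by simp)
      ⟨κ.toZFSet, (Ordinal.rank_toZFSet κ).le, by simp⟩
    simp only [if_true, List.cons.injEq, and_true] at hxκ
    exact hxκ ▸ hx
  have hjU : ∀ α ∈ S, ∀ x : ZFSet.{u}, x.rank ≤ α → j α x ∈ U := by
    intro α hα x hx
    have hαβ := (hSγ α hα).trans hγβ
    obtain ⟨y, hy, hyj⟩ := hwit false [V_ α, x]
      (by simp [hU.mem_of_rank_lt x (hx.trans_lt hαβ), hU.mem_of_rank_lt (V_ α)
        (by rwa [ZFSet.rank_vonNeumann])])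
      ⟨j α x, mem_Vset_add_one.1 ((hj α hα).1 x (mem_Vset_add_one.2 hx)), by simp⟩
    obtain ⟨α', x', h⟩ : ∃ α' x', [y, V_ α, x] = [j α' x', V_ α', x'] := by simpa using hyj
    simp only [List.cons.injEq, and_true] at h
    obtain ⟨rfl, hαα', rfl⟩ := h
    have hαα' := congrArg ZFSet.rank hαα'
    rw [ZFSet.rank_vonNeumann, ZFSet.rank_vonNeumann] at hαα'
    rwa [hαα']
  refine ⟨β, hγβ, Set.insert_subset hβκ hS.1, ?_⟩
  rintro α (rfl | hα) δ hαδ hδ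
  · rcases hδ with (rfl | hδ) | rfl
    · exact absurd hαδ (lt_irrefl _)
    · exact absurd ((hSγ δ hδ).trans hγβ) hαδ.not_gt
    · exact hU.nExtendibleTo_self hel hβκ hκU
  · rcases hδ with (rfl | hδ) | rfl
    · obtain ⟨-, h1, h2, h3⟩ := hj α hα
      exact hU.nExtendibleTo_of_mem hel hαδ hβκ h1 h2 h3 (hjU α hα)
    · exact hS.2 α hα δ hαδ (Or.inl hδ)
    · exact hS.2 α hα δ hαδ (Or.inr rfl)

end MarshallB2

/- STATEMENT 8.  If `V_{κ+2}` is a natural model of Marshall's theory `B₂`, then `κ` is a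
limit of a 1-extendible chain. -/
theorem statement8 (κ : Ordinal)
    (h : SatB2 (fun x y : {z : ZFSet // z.rank < κ + 2} => x.1 ∈ y.1)) :
    NExtendibleChainLimit 1 κ := by
  by_cases h0 : κ = 0
  · subst h0
    exact ⟨∅, Set.empty_subset _, fun γ hγ => absurd hγ not_lt_zero, fun α hα => hα.elim⟩
  have hκ := MarshallB2.isSuccLimit_of_satB2 h h0
  obtain ⟨S, hS⟩ := zorn_subset {S | MarshallB2.IsChainBelow κ S} (by
    intro C hC hchain
    refine ⟨⋃₀ C, ⟨Set.sUnion_subset fun S hS => (hC hS).1, ?_⟩,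
      fun S hS => Set.subset_sUnion_of_mem hS⟩
    rintro α ⟨S, hSC, hα⟩ β hαβ (⟨T, hTC, hβ⟩ | rfl)
    · rcases hchain.total hSC hTC with hST | hTS
      · exact (hC hTC).2 α (hST hα) β hαβ (Or.inl hβ)
      · exact (hC hSC).2 α hα β hαβ (Or.inl (hTS hβ))
    · exact (hC hSC).2 α hα _ hαβ (Or.inr rfl))
  refine ⟨S, hS.prop.1, fun γ hγ => ?_, hS.prop.2⟩
  by_contra! hSγ
  obtain ⟨β, hγβ, hβ⟩ := hS.prop.exists_insert h hκ hγ hSγ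
  exact (hγβ.trans (hSγ β (hS.le_of_ge hβ (Set.subset_insert β S) (Set.mem_insert β S)))).false
end

section
/- If κ is 2-extendible, or if κ is ℶ_{κ+1}-supercompact, then V_{κ+2} is a natural model of Marshall's theory B_2. -/
universe u

/-- `f` is (as a `ZFSet` of Kuratowski pairs) a function with domain `d`. -/
def ZFIsFuncOn (f d : ZFSet) : Prop :=
  (∀ p ∈ f, ∃ a b, a ∈ d ∧ p = ZFSet.pair a b) ∧ (∀ a ∈ d, ∃! b, ZFSet.pair a b ∈ f)

/-- `κ` is 2-extendible: for some `β` there is an elementary embedding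
`j : (V_{κ+2}, ∈) → (V_{β+2}, ∈)` with critical point `κ` and `j(κ) = β`. -/
def TwoExtendible (κ : Ordinal) : Prop := ∃ β, NExtendibleTo 2 κ β

/-- `κ` is `λ`-supercompact: there is an elementary embedding `j : V → M` into a
transitive class `M`, with critical point `κ`, `j(κ) > λ`, and `M` closed under
`λ`-sequences. -/
def LambdaSupercompact (κ lam : Ordinal) : Prop :=
  ∃ (Mc : Set ZFSet) (j : ZFSet → ZFSet),
    (∀ x ∈ Mc, ∀ y, y ∈ x → y ∈ Mc) ∧
    (∀ x, j x ∈ Mc) ∧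
    (∀ (φ : FOF) (ρ : ℕ → ZFSet),
      FOF.Eval (· ∈ ·) (fun _ => True) φ ρ ↔
        FOF.Eval (· ∈ ·) (· ∈ Mc) φ (fun i => j (ρ i))) ∧
    (∀ x : ZFSet, x.IsOrdinal → x.rank < κ → j x = x) ∧
    (∀ x : ZFSet, x.IsOrdinal → x.rank = κ → (j x).IsOrdinal ∧ lam < (j x).rank) ∧
    (∀ d f : ZFSet, d.IsOrdinal → d.rank = lam → ZFIsFuncOn f d →
      (∀ a b, a ∈ d → ZFSet.pair a b ∈ f → b ∈ Mc) → f ∈ Mc)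

open ZFSet Ordinal

namespace FOF

/-- Implication of formulas. -/
def imp (φ ψ : FOF) : FOF := .or (.not φ) ψ

/-- Equivalence of formulas. -/
def iff (φ ψ : FOF) : FOF := .and (imp φ ψ) (imp ψ φ)

section

variable {M : Type*} {E : M → M → Prop} {D : M → Prop}

theorem eval_imp (φ ψ : FOF) (ρ : ℕ → M) :
    (imp φ ψ).Eval E D ρ ↔ (φ.Eval E D ρ → ψ.Eval E D ρ) := by
  simp only [imp, Eval]; tauto

theorem eval_iff (φ ψ : FOF) (ρ : ℕ → M) :
    (iff φ ψ).Eval E D ρ ↔ (φ.Eval E D ρ ↔ ψ.Eval E D ρ) := by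
  simp only [iff, Eval, eval_imp]; tauto

theorem eval_congr_free (φ : FOF) {ρ σ : ℕ → M} (h : ∀ i ∈ φ.free, ρ i = σ i) :
    φ.Eval E D ρ ↔ φ.Eval E D σ := by
  have upd : ∀ (ψ : FOF) (i : ℕ) (x : M) (ρ σ : ℕ → M), (∀ k ∈ ψ.free \ {i}, ρ k = σ k) →
      ∀ k ∈ ψ.free, Function.update ρ i x k = Function.update σ i x k := by
    intro ψ i x ρ σ h k hk
    by_cases hki : k = i
    · subst hki; simp
    · simpa [hki] using h k ⟨hk, hki⟩
  induction φ generalizing ρ σ with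
  | eq i k => simp only [Eval]; rw [h i (by simp [free]), h k (by simp [free])]
  | mem i k => simp only [Eval]; rw [h i (by simp [free]), h k (by simp [free])]
  | not φ ih => exact not_congr (ih h)
  | and φ ψ ih₁ ih₂ =>
    exact and_congr (ih₁ fun i hi => h i (.inl hi)) (ih₂ fun i hi => h i (.inr hi))
  | or φ ψ ih₁ ih₂ =>
    exact or_congr (ih₁ fun i hi => h i (.inl hi)) (ih₂ fun i hi => h i (.inr hi))
  | all i φ ih =>
    simp only [Eval]
    exact forall₂_congr fun x _ => ih (upd φ i x ρ σ h)
  | ex i φ ih =>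
    simp only [Eval]
    exact exists_congr fun x => and_congr_right fun _ => ih (upd φ i x ρ σ h)

/-- The formula stating that every element of an element of variable `i` is an element of
variable `0`. -/
def subPowPow (i : ℕ) : FOF :=
  .all 1 (imp (.mem 1 i) (.all 2 (imp (.mem 2 1) (.mem 2 0))))

/-- The relativization of a formula to the double power class of variable `0`. The variables of
the formula are shifted by `20`. -/
def relPowPow : FOF → FOF
  | .eq i j => .eq (i + 20) (j + 20)
  | .mem i j => .mem (i + 20) (j + 20)
  | .not φ => .not φ.relPowPow
  | .and φ ψ => .and φ.relPowPow ψ.relPowPow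
  | .or φ ψ => .or φ.relPowPow ψ.relPowPow
  | .all i φ => .all (i + 20) (imp (subPowPow (i + 20)) φ.relPowPow)
  | .ex i φ => .ex (i + 20) (.and (subPowPow (i + 20)) φ.relPowPow)

theorem eval_subPowPow (i : ℕ) (ρ : ℕ → M) :
    (subPowPow (i + 20)).Eval E D ρ ↔
      ∀ y, D y → E y (ρ (i + 20)) → ∀ z, D z → E z y → E z (ρ 0) := by
  simp [subPowPow, eval_imp, Eval]

theorem eval_relPowPow (φ : FOF) (ρ : ℕ → M) :
    φ.relPowPow.Eval E D ρ ↔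
      φ.Eval E (fun x => D x ∧ ∀ y, D y → E y x → ∀ z, D z → E z y → E z (ρ 0))
        (fun i => ρ (i + 20)) := by
  have upd : ∀ (ρ : ℕ → M) (i : ℕ) (x : M),
      (fun k => Function.update ρ (i + 20) x (k + 20)) =
        Function.update (fun k => ρ (k + 20)) i x := by
    intro ρ i x; funext k; simp [Function.update_apply]
  have upd0 : ∀ (ρ : ℕ → M) (i : ℕ) (x : M), Function.update ρ (i + 20) x 0 = ρ 0 := by
    intro ρ i x; simp
  induction φ generalizing ρ with
  | eq i k => simp [relPowPow, Eval]
  | mem i k => simp [relPowPow, Eval]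
  | not φ ih => simp only [relPowPow, Eval, ih]
  | and φ ψ ih₁ ih₂ => simp only [relPowPow, Eval, ih₁, ih₂]
  | or φ ψ ih₁ ih₂ => simp only [relPowPow, Eval, ih₁, ih₂]
  | all i φ ih =>
    simp only [relPowPow, Eval, eval_imp, eval_subPowPow, ih, upd, upd0, Function.update_self,
      and_imp]
  | ex i φ ih =>
    simp only [relPowPow, Eval, eval_subPowPow, ih, upd, upd0, Function.update_self, and_assoc]

theorem eval_subtype_rel (D' : M → Prop) (φ : FOF) (ρ : ℕ → {z // D z}) :
    φ.Eval (fun x y => E x.1 y.1) (fun x => D' x.1) ρ ↔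
      φ.Eval E (fun x => D x ∧ D' x) (fun i => (ρ i).1) := by
  have upd : ∀ (ρ : ℕ → {z // D z}) (i : ℕ) (x : {z // D z}),
      (fun k => (Function.update ρ i x k).1) = Function.update (fun k => (ρ k).1) i x.1 := by
    intro ρ i x; funext k; simp only [Function.update_apply]; split_ifs <;> rfl
  induction φ generalizing ρ with
  | eq i k => simp [Eval, Subtype.ext_iff]
  | mem i k => simp [Eval]
  | not φ ih => simp only [Eval, ih]
  | and φ ψ ih₁ ih₂ => simp only [Eval, ih₁, ih₂]
  | or φ ψ ih₁ ih₂ => simp only [Eval, ih₁, ih₂]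
  | all i φ ih => simp [Eval, ih, upd]
  | ex i φ ih =>
    simp only [Eval, ih, upd]
    exact ⟨fun ⟨x, h1, h2⟩ => ⟨x.1, ⟨x.2, h1⟩, h2⟩, fun ⟨x, h1, h2⟩ => ⟨⟨x, h1.1⟩, h1.2, h2⟩⟩

theorem eval_subtype (φ : FOF) (ρ : ℕ → {z // D z}) :
    φ.Eval (fun x y => E x.1 y.1) (fun _ => True) ρ ↔ φ.Eval E D (fun i => (ρ i).1) := by
  simpa using eval_subtype_rel (E := E) (fun _ => True) φ ρ

/-- `p` is the Kuratowski pair of `a` and `b`. -/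
def kpair (p a b : ℕ) : FOF :=
  .all 15 (iff (.mem 15 p) (.or (.all 16 (iff (.mem 16 15) (.eq 16 a)))
    (.all 16 (iff (.mem 16 15) (.or (.eq 16 a) (.eq 16 b))))))

/-- `i` is empty. -/
def empty (i : ℕ) : FOF := .all 17 (.not (.mem 17 i))

/-- `i` is a class. -/
def isClass (i : ℕ) : FOF := .ex 18 (.mem i 18)

/-- `i` is a set. -/
def isSet (i : ℕ) : FOF := .ex 19 (.and (isClass 19) (.mem i 19))

/-- `p` is the pair of classes `[x, y]`. -/
def cpair (p x y : ℕ) : FOF :=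
  .all 12 (iff (.mem 12 p)
    (.or (.ex 13 (.ex 14 (.and (.mem 13 x) (.and (empty 14) (kpair 12 13 14)))))
      (.ex 13 (.ex 14 (.and (.mem 13 y)
        (.and (.all 11 (iff (.mem 11 14) (empty 11))) (kpair 12 13 14)))))))

/-- `w` is transitive and contains every subset of its elements. -/
def stc (w : ℕ) : FOF :=
  .and (.all 5 (imp (.mem 5 w) (.all 6 (imp (.mem 6 5) (.mem 6 w)))))
    (.all 5 (imp (.mem 5 w) (.all 6 (imp (.all 7 (imp (.mem 7 6) (.mem 7 5))) (.mem 6 w)))))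

/-- `b` is the relativization of the parameter `a` to `u`. -/
def relParam (u a b : ℕ) : FOF :=
  .or (.and (isClass a) (.all 5 (iff (.mem 5 b) (.and (.mem 5 a) (.mem 5 u)))))
    (.and (.not (isClass a))
      (.all 5 (iff (.mem 5 b) (.ex 6 (.and (.mem 6 a) (.and (.mem 6 u)
        (.all 7 (iff (.mem 7 5) (.and (.mem 7 6) (.mem 7 u))))))))))

/-- The conclusion of the reflection principle for a formula. -/
def reflection (φ : FOF) : FOF :=
  .ex 3 (.ex 0 (.ex 20 (.and (.all 5 (iff (.mem 5 0) (.and (.mem 5 3) (isSet 5))))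
    (.and (isSet 0) (.and (stc 0)
      (.and (.all 5 (.all 6 (imp (.mem 5 3) (imp (.mem 6 3)
          (.ex 7 (.and (.mem 7 3) (cpair 7 5 6)))))))
        (.and (relParam 3 4 20) φ.relPowPow)))))))

end

theorem eval_cpair {M : Type*} (E : M → M → Prop) (ρ : ℕ → M) :
    (cpair 0 1 2).Eval E (fun _ => True) ρ ↔ CPairI E (ρ 0) (ρ 1) (ρ 2) := by
  simp [cpair, CPairI, kpair, KpairB2, empty, EmptyB2, Eval, eval_iff]

theorem eval_isClass {M : Type*} (E : M → M → Prop) (ρ : ℕ → M) :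
    (isClass 0).Eval E (fun _ => True) ρ ↔ IsClassB2 E (ρ 0) := by
  simp [isClass, IsClassB2, Eval]

theorem eval_reflection {M : Type*} (E : M → M → Prop) (φ : FOF) (ρ : ℕ → M) :
    (reflection φ).Eval E (fun _ => True) ρ ↔
      ∃ u w b : M, (∀ z, E z w ↔ (E z u ∧ IsSetB2 E z)) ∧ IsSetB2 E w ∧ STCI E w ∧
        (∀ x y, E x u → E y u → ∃ p, E p u ∧ CPairI E p x y) ∧
        RelParamB2 E u (ρ 4) b ∧
        φ.Eval E (fun x => ∀ y, E y x → ∀ z, E z y → E z w)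
          (Function.update (fun i => ρ (i + 20)) 0 b) := by
  have upd : ∀ b : M, (fun i => if i = 0 then b else ρ (i + 20)) =
      Function.update (fun i => ρ (i + 20)) 0 b := by
    intro b; funext i; simp [Function.update_apply]
  simp [reflection, eval_relPowPow, upd, stc, STCI, relParam, RelParamB2, isSet, IsSetB2,
    isClass, IsClassB2, cpair, CPairI, kpair, KpairB2, empty, EmptyB2, Eval, eval_iff, eval_imp,
    Function.update_apply]

end FOF

/-- `j` is an elementary embedding of `V_{κ+2}` into a transitive class `K` with critical
point `κ`. -/
structure IsPowPowEmbedding (κ : Ordinal.{u}) (K : Set ZFSet.{u}) (j : ZFSet.{u} → ZFSet.{u}) :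
    Prop where
  trans : ∀ x ∈ K, ∀ y ∈ x, y ∈ K
  maps : ∀ x : ZFSet, x.rank < κ + 2 → j x ∈ K
  elementary : ∀ (φ : FOF) (ρ : ℕ → ZFSet), (∀ i, (ρ i).rank < κ + 2) →
    (φ.Eval (· ∈ ·) (fun x : ZFSet => x.rank < κ + 2) ρ ↔
      φ.Eval (· ∈ ·) (· ∈ K) (fun i => j (ρ i)))
  fix : ∀ x : ZFSet, x.IsOrdinal → x.rank < κ → j x = x
  crit : ∀ x : ZFSet, x.IsOrdinal → x.rank = κ → (j x).IsOrdinal ∧ κ < (j x).rank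

theorem lt_add_two_iff {a b : Ordinal.{u}} : a < b + 2 ↔ a ≤ b + 1 := by
  rw [show b + 2 = b + 1 + 1 by rw [add_assoc, one_add_one_eq_two], Order.lt_add_one_iff]

theorem lt_add_two_of_le {a b : Ordinal.{u}} (h : a ≤ b) : a < b + 2 :=
  lt_add_two_iff.2 (h.trans (Order.le_succ b))

theorem lt_add_two_of_lt {a b : Ordinal.{u}} (h : a < b) : a < b + 2 := lt_add_two_of_le h.le

theorem rank_lt_add_two_iff {κ : Ordinal.{u}} {x : ZFSet.{u}} :
    x.rank < κ + 2 ↔ ∀ y ∈ x, ∀ z ∈ y, z ∈ V_ κ := by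
  simp only [lt_add_two_iff, rank_le_iff, Order.lt_add_one_iff, mem_vonNeumann]

/-- In a transitive class, the sets satisfying the levels-of-the-hierarchy condition are
closed under elements of smaller rank. -/
theorem mem_of_rank_lt_of_history {K : Set ZFSet.{u}} (hK : ∀ x ∈ K, ∀ y ∈ x, y ∈ K)
    {H : ZFSet.{u}} (hH : H ∈ K)
    (hist : ∀ s ∈ K, s ∈ H → ∀ y ∈ K, (y ∈ s ↔ ∃ t ∈ K, t ∈ H ∧ t ∈ s ∧ ∀ z ∈ K, z ∈ y → z ∈ t))
    (s : ZFSet.{u}) (hs : s ∈ H) (y : ZFSet.{u}) (hy : y ∈ K) (hr : y.rank < s.rank) :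
    y ∈ s := by
  induction s using ZFSet.inductionOn generalizing y with
  | _ s ih =>
    obtain ⟨z, hz, hyz⟩ := lt_rank_iff.1 hr
    obtain ⟨t, htK, htH, hts, hzt⟩ := (hist s (hK _ hH _ hs) hs z
      (hK _ (hK _ hH _ hs) _ hz)).1 hz
    have hzt' : z ⊆ t := fun w hw => hzt w (hK _ (hK _ (hK _ hH _ hs) _ hz) _ hw) hw
    refine (hist s (hK _ hH _ hs) hs y hy).2 ⟨t, htK, htH, hts, fun w hwK hw => ?_⟩
    exact ih t hts htH w hwK (((rank_lt_of_mem hw).trans_le hyz).trans_le (rank_mono hzt'))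

namespace IsPowPowEmbedding

variable {κ : Ordinal.{u}} {K : Set ZFSet.{u}} {j : ZFSet.{u} → ZFSet.{u}}

theorem elementary₂ (h : IsPowPowEmbedding κ K j) (φ : FOF) {a b : ZFSet} (ha : a.rank < κ + 2)
    (hb : b.rank < κ + 2) :
    φ.Eval (· ∈ ·) (fun x : ZFSet => x.rank < κ + 2) (fun i => if i = 0 then a else b) ↔
      φ.Eval (· ∈ ·) (· ∈ K) (fun i => if i = 0 then j a else j b) := by
  have := h.elementary φ (fun i => if i = 0 then a else b) (fun i => by split_ifs <;> assumption)
  simpa only [apply_ite j] using this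

theorem mem_iff (h : IsPowPowEmbedding κ K j) {a b : ZFSet} (ha : a.rank < κ + 2)
    (hb : b.rank < κ + 2) : a ∈ b ↔ j a ∈ j b := by
  simpa [FOF.Eval] using h.elementary₂ (.mem 0 1) ha hb

theorem subset_iff (h : IsPowPowEmbedding κ K j) {a b : ZFSet} (ha : a.rank < κ + 2)
    (hb : b.rank < κ + 2) : a ⊆ b ↔ j a ⊆ j b := by
  have := h.elementary₂ (.all 4 (.imp (.mem 4 0) (.mem 4 1))) ha hb
  simp [FOF.Eval, FOF.eval_imp] at this
  constructor
  · intro hab x hx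
    exact this.1 (fun y _ hy => hab hy) x (h.trans _ (h.maps a ha) _ hx) hx
  · intro hab x hx
    exact this.2 (fun y _ hy => hab hy) x ((rank_lt_of_mem hx).trans ha) hx

/-- The set of levels of the cumulative hierarchy up to `κ`. -/
noncomputable def levels (κ : Ordinal.{u}) : ZFSet.{u} :=
  (V_ (κ + 1)).sep fun x => ∃ a, x = V_ a

theorem mem_levels {x : ZFSet.{u}} : x ∈ levels κ ↔ ∃ a ≤ κ, x = V_ a := by
  simp only [levels, mem_sep, mem_vonNeumann, Order.lt_add_one_iff]
  constructor
  · rintro ⟨h, a, rfl⟩; exact ⟨a, by simpa using h, rfl⟩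
  · rintro ⟨a, h, rfl⟩; exact ⟨by simpa using h, a, rfl⟩

theorem rank_levels_lt : (levels κ).rank < κ + 2 := by
  rw [lt_add_two_iff, rank_le_iff]
  intro x hx
  obtain ⟨a, ha, rfl⟩ := mem_levels.1 hx
  simpa using ha

theorem mem_image_vonNeumann_of_rank_lt (h : IsPowPowEmbedding κ K j) {a : Ordinal.{u}}
    (ha : a ≤ κ) {y : ZFSet} (hy : y ∈ K) (hr : y.rank < (j (V_ a)).rank) : y ∈ j (V_ a) := by
  have := (h.elementary₂ (.all 4 (.imp (.mem 4 0) (.all 5 (.iff (.mem 5 4)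
    (.ex 6 (.and (.mem 6 0) (.and (.mem 6 4) (.all 7 (.imp (.mem 7 5) (.mem 7 6))))))))))
    (rank_levels_lt (κ := κ)) (rank_levels_lt (κ := κ))).1 ?_
  · simp [FOF.Eval, FOF.eval_imp, FOF.eval_iff] at this
    refine mem_of_rank_lt_of_history h.trans (h.maps _ rank_levels_lt) this _ ?_ y hy hr
    refine (h.mem_iff ?_ rank_levels_lt).1 (mem_levels.2 ⟨a, ha, rfl⟩)
    rw [rank_vonNeumann]
    exact lt_add_two_of_le ha
  · simp only [FOF.Eval, FOF.eval_imp, FOF.eval_iff]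
    simp
    intro s hs hsl y hy
    obtain ⟨b, hb, rfl⟩ := mem_levels.1 hsl
    constructor
    · intro hyb
      refine ⟨V_ y.rank, ?_, mem_levels.2 ⟨_, ?_, rfl⟩, ?_, ?_⟩
      · simpa using hy
      · exact (mem_vonNeumann.1 hyb).le.trans hb
      · simpa using mem_vonNeumann.1 hyb
      · exact fun z _ hz => mem_vonNeumann.2 (rank_lt_of_mem hz)
    · rintro ⟨t, ht, htl, htb, hyt⟩
      refine mem_vonNeumann_of_subset (y := t) (fun z hz => ?_) htb
      exact hyt z ((rank_lt_of_mem hz).trans hy) hz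

theorem image_vonNeumann_subset (h : IsPowPowEmbedding κ K j) {a : Ordinal.{u}}
    (ha : a < κ) : j (V_ a) ⊆ V_ a := by
  intro y hy
  have hfix : j a.toZFSet = a.toZFSet := h.fix _ (isOrdinal_toZFSet a) (by simpa using ha)
  have har : a.toZFSet.rank < κ + 2 := by simpa using lt_add_two_of_lt ha
  have hn : a.toZFSet ∉ j (V_ a) := by
    rw [← hfix, ← h.mem_iff har (by simpa using lt_add_two_of_lt ha), mem_vonNeumann]
    simp
  have hK : a.toZFSet ∈ K := hfix ▸ h.maps _ har
  have := mt (h.mem_image_vonNeumann_of_rank_lt ha.le hK) hn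
  rw [rank_toZFSet, not_lt] at this
  exact mem_vonNeumann.2 ((rank_lt_of_mem hy).trans_le this)

theorem apply_eq_self (h : IsPowPowEmbedding κ K j) (x : ZFSet) (hx : x.rank < κ) : j x = x := by
  have hx2 := lt_add_two_of_lt hx
  ext y
  constructor
  · intro hy
    have hyr : y.rank < x.rank := mem_vonNeumann.1 <| h.image_vonNeumann_subset hx <|
      (h.subset_iff hx2 (by simpa using hx2)).1 (subset_vonNeumann_self x) hy
    rw [← h.apply_eq_self y (hyr.trans hx), ← h.mem_iff (hyr.trans hx2) hx2] at hy
    exact hy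
  · intro hy
    have hyr : y.rank < x.rank := rank_lt_of_mem hy
    rw [← h.apply_eq_self y (hyr.trans hx)]
    exact (h.mem_iff (hyr.trans hx2) hx2).1 hy
termination_by x.rank

theorem vonNeumann_mem_image (h : IsPowPowEmbedding κ K j) (hK : V_ κ ∈ K) : V_ κ ∈ j (V_ κ) := by
  apply h.mem_image_vonNeumann_of_rank_lt le_rfl hK
  rw [rank_vonNeumann]
  refine (h.crit _ (isOrdinal_toZFSet κ) (rank_toZFSet κ)).2.trans_le (rank_mono ?_)
  refine (h.subset_iff ?_ ?_).1 κ.toZFSet_subset_vonNeumann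
  · simp
  · simp

theorem add_one_lt (h : IsPowPowEmbedding κ K j) {a : Ordinal.{u}} (ha : a < κ) : a + 1 < κ := by
  by_contra! hle
  have hκr : κ.toZFSet.rank < κ + 2 := by simp
  have har : a.toZFSet.rank < κ + 2 := by simpa using lt_add_two_of_lt ha
  have := (h.elementary₂ (.all 4 (.imp (.mem 4 0) (.or (.mem 4 1) (.eq 4 1)))) hκr har).1 (by
    simp [FOF.Eval, FOF.eval_imp]
    intro x _ hx
    obtain ⟨b, hb, rfl⟩ := mem_toZFSet_iff.1 hx
    rcases (Order.lt_add_one_iff.1 (hb.trans_le hle)).lt_or_eq with hlt | rfl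
    · exact .inl (toZFSet_mem_toZFSet_iff.2 hlt)
    · exact .inr rfl)
  simp [FOF.Eval, FOF.eval_imp] at this
  refine (h.crit _ (isOrdinal_toZFSet κ) (rank_toZFSet κ)).2.not_ge (rank_le_iff.2 fun y hy => ?_)
  rw [h.fix _ (isOrdinal_toZFSet a) (by simpa using ha)] at this
  rcases this y (h.trans _ (h.maps _ hκr) _ hy) hy with hya | rfl
  · simpa using (rank_lt_of_mem hya).trans (by simpa using ha)
  · simpa using ha

theorem vonNeumann_rank_lt : (V_ κ).rank < κ + 2 := by simp

theorem mem_image_of_mem_of_mem (h : IsPowPowEmbedding κ K j) {x y z : ZFSet} (hx : x ∈ K)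
    (hy : y ∈ x) (hz : z ∈ y) : z ∈ j (V_ κ) := by
  have := (h.elementary₂ (.all 4 (.all 5 (.imp (.mem 5 4) (.all 6 (.imp (.mem 6 5) (.mem 6 0))))))
    (vonNeumann_rank_lt (κ := κ)) (vonNeumann_rank_lt (κ := κ))).1 (by
    simp [FOF.Eval, FOF.eval_imp]
    intro x hx y _ hy z _ hz
    exact rank_lt_add_two_iff.1 hx y hy z hz)
  simp [FOF.Eval, FOF.eval_imp] at this
  exact this x hx y (h.trans _ hx _ hy) hy z (h.trans _ (h.trans _ hx _ hy) _ hz) hz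

theorem mem_image_vonNeumann_add_one (h : IsPowPowEmbedding κ K j) {x : ZFSet} (hx : x ∈ K) :
    x ∈ j (V_ (κ + 1)) ↔ x ⊆ j (V_ κ) := by
  have hr : (V_ (κ + 1)).rank < κ + 2 := by simp
  have := (h.elementary₂ (.all 4 (.iff (.mem 4 1) (.all 5 (.imp (.mem 5 4) (.mem 5 0)))))
    (vonNeumann_rank_lt (κ := κ)) hr).1 (by
    simp [FOF.Eval, FOF.eval_imp, FOF.eval_iff, -vonNeumann_add_one]
    intro x hx
    rw [vonNeumann_add_one, mem_powerset]
    exact ⟨fun hxs y _ hy => hxs hy, fun hxs y hy => hxs y ((rank_lt_of_mem hy).trans hx) hy⟩)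
  simp [FOF.Eval, FOF.eval_imp, FOF.eval_iff, -vonNeumann_add_one] at this
  rw [this x hx]
  exact ⟨fun hxs y hy => hxs y (h.trans _ hx _ hy) hy, fun hxs y _ hy => hxs hy⟩

end IsPowPowEmbedding

theorem kpair_iff {D : ZFSet.{u} → Prop} (hD : ∀ x, D x → ∀ y ∈ x, D y) {p a b : ZFSet.{u}}
    (hp : D p) (ha : D a) (hb : D b) (hsa : D {a}) (hsab : D {a, b}) :
    (∀ z, D z → (z ∈ p ↔ ((∀ w, D w → (w ∈ z ↔ w = a)) ∨
      (∀ w, D w → (w ∈ z ↔ (w = a ∨ w = b)))))) ↔ p = pair a b := by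
  have h1 : ∀ z, D z → ((∀ w, D w → (w ∈ z ↔ w = a)) ↔ z = {a}) := by
    intro z hz
    constructor
    · intro h; ext w
      rw [mem_singleton]
      exact ⟨fun hw => (h w (hD z hz w hw)).1 hw, fun hw => (h w (hw ▸ ha)).2 hw⟩
    · rintro rfl w _; simp
  have h2 : ∀ z, D z → ((∀ w, D w → (w ∈ z ↔ (w = a ∨ w = b))) ↔ z = {a, b}) := by
    intro z hz
    constructor
    · intro h; ext w
      rw [mem_pair]
      exact ⟨fun hw => (h w (hD z hz w hw)).1 hw,
        fun hw => (h w (by rcases hw with rfl | rfl <;> assumption)).2 hw⟩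
    · rintro rfl w _; simp
  constructor
  · intro h
    ext z
    rw [pair, mem_pair]
    constructor
    · intro hz
      have hz' := hD p hp z hz
      rw [h z hz', h1 z hz', h2 z hz'] at hz
      exact hz
    · intro hz
      have hz' : D z := by rcases hz with rfl | rfl <;> assumption
      rw [h z hz', h1 z hz', h2 z hz']
      exact hz
  · rintro rfl z hz
    rw [h1 z hz, h2 z hz, pair, mem_pair]

theorem kpairB2_iff {D : ZFSet.{u} → Prop} (hD : ∀ x, D x → ∀ y ∈ x, D y) (p a b : {z // D z})
    (hsa : D {a.1}) (hsab : D {a.1, b.1}) :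
    KpairB2 (fun x y : {z // D z} => x.1 ∈ y.1) p a b ↔ p.1 = pair a.1 b.1 := by
  rw [← kpair_iff hD p.2 a.2 b.2 hsa hsab]
  simp [KpairB2, Subtype.forall, Subtype.ext_iff]

section

variable {κ : Ordinal.{u}}

/-- `V_{κ+2}` as a type. -/
abbrev PowPow (κ : Ordinal.{u}) : Type (u + 1) := {z : ZFSet.{u} // z.rank < κ + 2}

theorem isClassB2_iff (x : PowPow κ) :
    IsClassB2 (fun x y : PowPow κ => x.1 ∈ y.1) x ↔ x.1.rank < κ + 1 := by
  constructor
  · rintro ⟨c, hc⟩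
    exact (rank_lt_of_mem hc).trans_le (lt_add_two_iff.1 c.2)
  · intro hx
    refine ⟨⟨{x.1}, ?_⟩, by simp⟩
    rw [lt_add_two_iff, rank_singleton]
    exact Order.succ_le_of_lt hx

theorem exists_cPairI (hκ : ∀ a < κ, a + 1 < κ) (x y : PowPow κ) (hx : x.1.rank < κ + 1)
    (hy : y.1.rank < κ + 1) :
    ∃ p : PowPow κ, p.1.rank < κ + 1 ∧ CPairI (fun x y : PowPow κ => x.1 ∈ y.1) p x y := by
  have hD : ∀ x : ZFSet, x.rank < κ + 2 → ∀ y ∈ x, y.rank < κ + 2 :=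
    fun x hx y hy => (rank_lt_of_mem hy).trans hx
  have hpos : ∀ a < κ, 0 < κ := fun a ha => (zero_le (a := a)).trans_lt ha
  have hsing : ∀ a : ZFSet, a.rank < κ → ({a} : ZFSet).rank < κ := fun a ha => by
    rw [rank_singleton]; exact hκ _ ha
  have hdbl : ∀ a b : ZFSet, a.rank < κ → b.rank < κ → ({a, b} : ZFSet).rank < κ :=
    fun a b ha hb => by rw [rank_pair]; exact max_lt (hκ _ ha) (hκ _ hb)
  have hpair : ∀ a b : ZFSet, a.rank < κ → b.rank < κ → (pair a b).rank < κ :=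
    fun a b ha hb => hdbl _ _ (hsing a ha) (hdbl a b ha hb)
  have hmem : ∀ c : PowPow κ, c.1.rank < κ + 1 → ∀ a ∈ c.1, a.rank < κ := fun c hc a ha =>
    (rank_lt_of_mem ha).trans_le (Order.lt_add_one_iff.1 hc)
  have hkp : ∀ p a b : PowPow κ, a.1.rank < κ → b.1.rank < κ →
      (KpairB2 (fun x y : PowPow κ => x.1 ∈ y.1) p a b ↔ p.1 = pair a.1 b.1) := fun p a b ha hb =>
    kpairB2_iff hD p a b (lt_add_two_of_lt (hsing _ ha)) (lt_add_two_of_lt (hdbl _ _ ha hb))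
  have hempty : ∀ t : PowPow κ, EmptyB2 (fun x y : PowPow κ => x.1 ∈ y.1) t ↔ t.1 = ∅ := by
    intro t
    rw [ZFSet.eq_empty]
    exact ⟨fun h w hw => h ⟨w, hD _ t.2 w hw⟩ hw, fun h w => h w.1⟩
  have hone : ∀ t : PowPow κ, (∀ w : PowPow κ, w.1 ∈ t.1 ↔
      EmptyB2 (fun x y : PowPow κ => x.1 ∈ y.1) w) ↔ t.1 = {∅} := by
    intro t
    constructor
    · intro h; ext w
      rw [mem_singleton]
      constructor
      · intro hw
        exact (hempty ⟨w, hD _ t.2 w hw⟩).1 ((h ⟨w, hD _ t.2 w hw⟩).1 hw)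
      · rintro rfl
        exact (h ⟨∅, by rw [rank_empty, lt_add_two_iff]; exact zero_le⟩).2 ((hempty _).2 rfl)
    · intro h w
      rw [h, mem_singleton, hempty]
  let c : ZFSet := (V_ κ).sep fun z =>
    (∃ a ∈ x.1, z = pair a ∅) ∨ ∃ b ∈ y.1, z = pair b {∅}
  have hc : c.rank < κ + 1 := Order.lt_add_one_iff.2 <| subset_vonNeumann.1 fun z hz =>
    (mem_sep.1 hz).1
  refine ⟨⟨c, lt_add_two_of_le (Order.lt_add_one_iff.1 hc)⟩, hc, fun z => ?_⟩
  simp only [c, mem_sep, mem_vonNeumann]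
  constructor
  · rintro ⟨-, ⟨a, ha, hz⟩ | ⟨b, hb, hz⟩⟩
    · have har := hmem x hx a ha
      have h0 : (∅ : ZFSet.{u}).rank < κ := by simpa using hpos _ har
      exact .inl ⟨⟨a, lt_add_two_of_lt har⟩, ⟨∅, lt_add_two_of_lt h0⟩, ha, (hempty _).2 rfl,
        (hkp _ _ _ har h0).2 hz⟩
    · have hbr := hmem y hy b hb
      have h0 : (∅ : ZFSet.{u}).rank < κ := by simpa using hpos _ hbr
      exact .inr ⟨⟨b, lt_add_two_of_lt hbr⟩, ⟨{∅}, lt_add_two_of_lt (hsing _ h0)⟩, hb,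
        (hone _).2 rfl, (hkp _ _ _ hbr (hsing _ h0)).2 hz⟩
  · rintro (⟨a, t, ha, ht, hz⟩ | ⟨b, t, hb, ht, hz⟩)
    · have har := hmem x hx a ha
      have h0 : (∅ : ZFSet.{u}).rank < κ := by simpa using hpos _ har
      rw [hempty] at ht
      rw [hkp _ _ _ har (by rwa [ht]), ht] at hz
      exact ⟨hz ▸ hpair _ _ har h0, .inl ⟨a.1, ha, hz⟩⟩
    · have hbr := hmem y hy b hb
      have h0 : (∅ : ZFSet.{u}).rank < κ := by simpa using hpos _ hbr
      rw [hone] at ht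
      rw [hkp _ _ _ hbr (by rw [ht]; exact hsing _ h0), ht] at hz
      exact ⟨hz ▸ hpair _ _ hbr (hsing _ h0), .inr ⟨b.1, hb, hz⟩⟩

/-- `V_{κ+2}` is a model of `B₂` as soon as it embeds elementarily, with critical point `κ`,
into a transitive class that contains `V_{κ+2}` and the pointwise image of `V_{κ+1}`. -/
theorem IsPowPowEmbedding.satB2 {K : Set ZFSet.{u}} {j : ZFSet.{u} → ZFSet.{u}}
    (h : IsPowPowEmbedding κ K j) (hsub : ∀ x : ZFSet, x.rank < κ + 2 → x ∈ K)
    {U : ZFSet.{u}} (hUK : U ∈ K) (hU : ∀ z, z ∈ U ↔ ∃ x : ZFSet, x.rank < κ + 1 ∧ z = j x) :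
    SatB2 (fun x y : PowPow κ => x.1 ∈ y.1) := by
  have hD : ∀ x : ZFSet, x.rank < κ + 2 → ∀ y ∈ x, y.rank < κ + 2 :=
    fun x hx y hy => (rank_lt_of_mem hy).trans hx
  have hext : ∀ {a b : PowPow κ}, (∀ z : PowPow κ, z.1 ∈ a.1 ↔ z.1 ∈ b.1) → a = b :=
    fun {a b} hab => Subtype.ext <| ZFSet.ext fun z => ⟨fun hz => (hab ⟨z, hD _ a.2 z hz⟩).1 hz,
      fun hz => (hab ⟨z, hD _ b.2 z hz⟩).2 hz⟩
  refine ⟨fun φ ρ => ?_, fun A B => hext, fun φ hφ ρ hρ => ?_, fun A hA => ?_, fun x _ hx => ?_⟩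
  · refine ⟨⟨(V_ (κ + 1)).sep fun z => ∃ hz : z.rank < κ + 2,
      φ.Eval (fun x y : PowPow κ => x.1 ∈ y.1) (fun _ => True) (Function.update ρ 0 ⟨z, hz⟩), ?_⟩,
      fun x => ?_⟩
    · rw [lt_add_two_iff, ← subset_vonNeumann]
      exact fun z hz => (mem_sep.1 hz).1
    · rw [isClassB2_iff]
      simp only [mem_sep, mem_vonNeumann]
      exact ⟨fun ⟨h1, _, h2⟩ => ⟨h2, h1⟩, fun ⟨h2, h1⟩ => ⟨h1, x.2, h2⟩⟩
  · let i : PowPow κ → {z // z ∈ K} := fun x => ⟨j x.1, h.maps _ x.2⟩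
    have tr : ∀ (χ : FOF) (σ : ℕ → PowPow κ),
        χ.Eval (fun x y : PowPow κ => x.1 ∈ y.1) (fun _ => True) σ ↔
        χ.Eval (fun x y : {z // z ∈ K} => x.1 ∈ y.1) (fun _ => True) (fun k => i (σ k)) := by
      intro χ σ
      have h1 := FOF.eval_subtype (E := (· ∈ ·)) χ σ
      have h2 := FOF.eval_subtype (E := (· ∈ ·)) χ (fun k => i (σ k))
      rw [h1, h2]
      exact h.elementary χ _ fun k => (σ k).2
    have hclass : ∀ x : {z // z ∈ K},
        IsClassB2 (fun x y : {z // z ∈ K} => x.1 ∈ y.1) x ↔ x.1 ⊆ j (V_ κ) := by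
      intro x
      constructor
      · rintro ⟨c, hc⟩ z hz
        exact h.mem_image_of_mem_of_mem c.2 hc hz
      · intro hx
        exact ⟨⟨j (V_ (κ + 1)), h.maps _ (by simp)⟩,
          (h.mem_image_vonNeumann_add_one x.2).2 hx⟩
    have hset : ∀ x : {z // z ∈ K},
        IsSetB2 (fun x y : {z // z ∈ K} => x.1 ∈ y.1) x ↔ x.1 ∈ j (V_ κ) := by
      intro x
      constructor
      · rintro ⟨c, hc, hxc⟩
        exact (hclass c).1 hc hxc
      · intro hx
        exact ⟨⟨j (V_ κ), h.maps _ vonNeumann_rank_lt⟩, (hclass _).2 fun _ => id, hx⟩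
    have hVK : V_ κ ∈ K := hsub _ vonNeumann_rank_lt
    have hlow : ∀ x : ZFSet, x.rank < κ → x ∈ j (V_ κ) := fun x hx => by
      rw [← h.apply_eq_self x hx, ← h.mem_iff (lt_add_two_of_lt hx) vonNeumann_rank_lt]
      exact mem_vonNeumann.2 hx
    have hlowU : ∀ x : ZFSet, x.rank < κ → x ∈ U := fun x hx =>
      (hU x).2 ⟨x, hx.trans (Order.lt_succ κ), (h.apply_eq_self x hx).symm⟩
    have hUlow : ∀ x : ZFSet, x.rank < κ + 2 → j x ∈ j (V_ κ) → x.rank < κ := fun x hx hjx =>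
      mem_vonNeumann.1 ((h.mem_iff hx vonNeumann_rank_lt).2 hjx)
    have hsucc : ∀ x : ZFSet, x.rank < κ + 1 → x.rank < κ + 2 := fun x hx =>
      lt_add_two_iff.2 hx.le
    let τ : ℕ → PowPow κ := fun k => ρ (k - 20)
    have key := (FOF.eval_reflection (fun x y : {z // z ∈ K} => x.1 ∈ y.1) φ
      (fun k => i (τ k))).2
      ⟨⟨U, hUK⟩, ⟨V_ κ, hVK⟩, ⟨(ρ 0).1, hsub _ (ρ 0).2⟩, ?_, ?_, ?_, ?_, ?_, ?_⟩
    · rw [← tr, FOF.eval_reflection] at key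
      exact key
    · intro z
      rw [hset]
      constructor
      · intro hz
        have := mem_vonNeumann.1 hz
        exact ⟨hlowU _ this, hlow _ this⟩
      · rintro ⟨hzU, hz⟩
        obtain ⟨x, hx, hzx⟩ := (hU _).1 hzU
        have hxκ := hUlow x (hsucc x hx) (hzx ▸ hz)
        rw [h.apply_eq_self x hxκ] at hzx
        exact mem_vonNeumann.2 (hzx ▸ hxκ)
    · exact (hset _).2 (h.vonNeumann_mem_image hVK)
    · refine ⟨fun y hy z hz => (isTransitive_vonNeumann κ).mem_trans hz hy, fun y hy x hx => ?_⟩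
      exact mem_vonNeumann_of_subset
        (fun z hz => hx ⟨z, h.trans _ x.2 z hz⟩ hz) hy
    · rintro ⟨x, hxK⟩ ⟨y, hyK⟩ hx hy
      obtain ⟨a, ha, rfl⟩ := (hU _).1 hx
      obtain ⟨b, hb, rfl⟩ := (hU _).1 hy
      obtain ⟨p, hp, hpc⟩ := exists_cPairI (fun a ha => h.add_one_lt ha) ⟨a, hsucc a ha⟩
        ⟨b, hsucc b hb⟩ ha hb
      refine ⟨i p, (hU _).2 ⟨p.1, hp, rfl⟩, ?_⟩
      have := (tr (FOF.cpair 0 1 2) fun k => if k = 0 then p else if k = 1 then ⟨a, hsucc a ha⟩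
        else ⟨b, hsucc b hb⟩).1 ((FOF.eval_cpair _ _).2 hpc)
      exact (FOF.eval_cpair _ _).1 this
    · have hcl : IsClassB2 (fun x y : {z // z ∈ K} => x.1 ∈ y.1) (i (ρ 0)) ↔
          (ρ 0).1.rank < κ + 1 := by
        rw [← isClassB2_iff]
        have := tr (FOF.isClass 0) ρ
        rw [FOF.eval_isClass, FOF.eval_isClass] at this
        exact this.symm
      by_cases hA : (ρ 0).1.rank < κ + 1
      · refine .inl ⟨hcl.2 hA, fun z => ⟨fun hz => ?_, ?_⟩⟩
        · have hzr : z.1.rank < κ := (rank_lt_of_mem hz).trans_le (Order.lt_add_one_iff.1 hA)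
          refine ⟨?_, hlowU _ hzr⟩
          have := (h.mem_iff (lt_add_two_of_lt hzr) (ρ 0).2).1 hz
          rwa [h.apply_eq_self _ hzr] at this
        · rintro ⟨hzA, hzU⟩
          obtain ⟨x, hx, hzx⟩ := (hU _).1 hzU
          have hzA' : j x ∈ j (ρ 0).1 := hzx ▸ hzA
          have hxA := (h.mem_iff (hsucc x hx) (ρ 0).2).2 hzA'
          have hxr : x.rank < κ := (rank_lt_of_mem hxA).trans_le (Order.lt_add_one_iff.1 hA)
          rw [h.apply_eq_self x hxr] at hzx
          exact (hzx ▸ hxA : z.1 ∈ (ρ 0).1)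
      · have hinter : ∀ x : ZFSet, x.rank < κ + 1 → ∀ w, w ∈ x ↔ w ∈ j x ∧ w ∈ U := by
          intro x hx w
          constructor
          · intro hw
            have hwr : w.rank < κ := (rank_lt_of_mem hw).trans_le (Order.lt_add_one_iff.1 hx)
            refine ⟨?_, hlowU _ hwr⟩
            have := (h.mem_iff (lt_add_two_of_lt hwr) (hsucc x hx)).1 hw
            rwa [h.apply_eq_self _ hwr] at this
          · rintro ⟨hwx, hwU⟩
            obtain ⟨y, hy, rfl⟩ := (hU _).1 hwU
            have hyx := (h.mem_iff (hsucc y hy) (hsucc x hx)).2 hwx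
            rwa [h.apply_eq_self y
              ((rank_lt_of_mem hyx).trans_le (Order.lt_add_one_iff.1 hx))]
        refine .inr ⟨mt hcl.1 hA, fun z => ⟨fun hz => ?_, ?_⟩⟩
        · have hzr : z.1.rank < κ + 1 := (rank_lt_of_mem hz).trans_le (lt_add_two_iff.1 (ρ 0).2)
          exact ⟨i ⟨z.1, hsucc _ hzr⟩, (h.mem_iff (hsucc _ hzr) (ρ 0).2).1 hz,
            (hU _).2 ⟨_, hzr, rfl⟩, fun w => hinter z.1 hzr w.1⟩
        · rintro ⟨x, hxA, hxU, hxz⟩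
          obtain ⟨y, hy, hyx⟩ := (hU _).1 hxU
          have hxA' : j y ∈ j (ρ 0).1 := hyx ▸ hxA
          have hyA := (h.mem_iff (hsucc y hy) (ρ 0).2).2 hxA'
          have : z.1 = y := by
            ext w
            rw [hinter y hy w, ← hyx]
            exact ⟨fun hw => (hxz ⟨w, h.trans _ z.2 w hw⟩).1 hw,
              fun hw => (hxz ⟨w, h.trans _ x.2 w hw.1⟩).2 hw⟩
          exact (this ▸ hyA : z.1 ∈ (ρ 0).1)
    · have h1 := (FOF.eval_subtype (E := (· ∈ ·)) φ ρ).1 hρ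
      have h2 : (fun x : ZFSet => x ∈ K ∧ ∀ y : {z // z ∈ K}, y.1 ∈ x → ∀ z : {z // z ∈ K},
          z.1 ∈ y.1 → z.1 ∈ V_ κ) =
          fun x => x.rank < κ + 2 := by
        funext x
        rw [eq_iff_iff, rank_lt_add_two_iff]
        constructor
        · rintro ⟨hx, hxs⟩ y hy z hz
          exact hxs ⟨y, h.trans _ hx _ hy⟩ hy ⟨z, h.trans _ (h.trans _ hx _ hy) _ hz⟩ hz
        · intro hx
          exact ⟨hsub x (rank_lt_add_two_iff.2 hx), fun y hy z hz => hx y.1 hy z.1 hz⟩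
      have h3 := FOF.eval_subtype_rel (D := (· ∈ K)) (E := (· ∈ ·))
        (fun x => ∀ y : {z // z ∈ K}, y.1 ∈ x → ∀ z : {z // z ∈ K}, z.1 ∈ y.1 → z.1 ∈ V_ κ) φ
        (Function.update (fun k => i (τ (k + 20))) 0 ⟨(ρ 0).1, hsub _ (ρ 0).2⟩)
      refine h3.2 ?_
      rw [h2]
      refine (FOF.eval_congr_free φ fun k hk => ?_).1 h1
      obtain rfl : k = 0 := hφ hk
      simp
  · obtain ⟨x, hx⟩ := hA
    obtain ⟨y, hy, hyA⟩ := regularity A.1 (fun h0 => by rw [h0] at hx; exact notMem_empty _ hx)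
    refine ⟨⟨y, hD _ A.2 y hy⟩, hy, fun z hz => ?_⟩
    have : z.1 ∈ A.1 ∩ y := mem_inter.2 ⟨hz.2, hz.1⟩
    rw [hyA] at this
    exact notMem_empty _ this
  · classical
    let c : ZFSet → ZFSet := fun y => if hy : ∃ z, z ∈ y then hy.choose else ∅
    have hc : ∀ y z : ZFSet, z ∈ y → c y ∈ y := fun y z hz => by
      have hy : ∃ z, z ∈ y := ⟨z, hz⟩
      simp only [c, dif_pos hy]
      exact hy.choose_spec
    let S : ZFSet := (⋃₀ x.1 : ZFSet).sep fun z => ∃ y ∈ x.1, c y ∈ y ∧ z = c y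
    have hS : ∀ z, z ∈ S ↔ z ∈ (⋃₀ x.1 : ZFSet) ∧ ∃ y ∈ x.1, c y ∈ y ∧ z = c y :=
      fun z => mem_sep
    refine ⟨⟨S, ?_⟩, fun y hy hne => ?_⟩
    · refine (rank_mono fun z hz => ((hS z).1 hz).1).trans_lt ((rank_sUnion_le x.1).trans_lt x.2)
    · obtain ⟨z, hz⟩ := hne
      have hcy := hc _ _ hz
      refine ⟨⟨c y.1, hD _ y.2 _ hcy⟩, ⟨hcy, ?_⟩, ?_⟩
      · exact (hS _).2 ⟨mem_sUnion.2 ⟨y.1, hy, hcy⟩, y.1, hy, hcy, rfl⟩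
      · rintro w ⟨hwy, hw⟩
        obtain ⟨-, y', hy', hcy', hwy'⟩ := (hS w.1).1 hw
        have hyy : y = (⟨y', hD _ x.2 _ hy'⟩ : PowPow κ) := by
          by_contra hne
          exact hx y ⟨y', hD _ x.2 _ hy'⟩ hy hy' hne ⟨w, hwy, show w.1 ∈ y' from hwy'.symm ▸ hcy'⟩
        exact Subtype.ext (hwy'.trans (congrArg (fun t => c t.1) hyy).symm)

end

/-- `j` is an elementary embedding of the universe into a transitive class `N` closed under
`lam`-sequences, with critical point `κ` and `j(κ) > lam`. -/
structure IsSupercompactEmbedding (κ lam : Ordinal.{u}) (N : Set ZFSet.{u})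
    (j : ZFSet.{u} → ZFSet.{u}) : Prop where
  trans : ∀ x ∈ N, ∀ y ∈ x, y ∈ N
  maps : ∀ x, j x ∈ N
  elementary : ∀ (φ : FOF) (ρ : ℕ → ZFSet),
    φ.Eval (· ∈ ·) (fun _ => True) ρ ↔ φ.Eval (· ∈ ·) (· ∈ N) (fun i => j (ρ i))
  fix : ∀ x : ZFSet, x.IsOrdinal → x.rank < κ → j x = x
  crit : ∀ x : ZFSet, x.IsOrdinal → x.rank = κ → (j x).IsOrdinal ∧ lam < (j x).rank
  closed : ∀ d f : ZFSet, d.IsOrdinal → d.rank = lam → ZFIsFuncOn f d →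
    (∀ a b, a ∈ d → pair a b ∈ f → b ∈ N) → f ∈ N

namespace IsSupercompactEmbedding

variable {κ lam : Ordinal.{u}} {N : Set ZFSet.{u}} {j : ZFSet.{u} → ZFSet.{u}}

theorem elementary₂ (h : IsSupercompactEmbedding κ lam N j) (φ : FOF) (a b : ZFSet) :
    φ.Eval (· ∈ ·) (fun _ => True) (fun i => if i = 0 then a else b) ↔
      φ.Eval (· ∈ ·) (· ∈ N) (fun i => if i = 0 then j a else j b) := by
  simpa only [apply_ite j] using h.elementary φ (fun i => if i = 0 then a else b)

theorem pair_mem (h : IsSupercompactEmbedding κ lam N j) {a b : ZFSet} (ha : a ∈ N) (hb : b ∈ N) :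
    ({a, b} : ZFSet) ∈ N := by
  have := (h.elementary₂ (.all 4 (.all 5 (.ex 6 (.all 7 (.iff (.mem 7 6)
    (.or (.eq 7 4) (.eq 7 5))))))) ∅ ∅).1 (by
    simp [FOF.Eval, FOF.eval_iff]
    exact fun x y => ⟨{x, y}, fun z => mem_pair⟩)
  simp [FOF.Eval, FOF.eval_iff] at this
  obtain ⟨p, hp, hpz⟩ := this a ha b hb
  convert hp using 1
  ext z
  rw [mem_pair]
  constructor
  · intro hz
    exact (hpz z (by rcases hz with rfl | rfl <;> assumption)).2 hz
  · exact fun hz => (hpz z (h.trans _ hp _ hz)).1 hz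

theorem exists_range (h : IsSupercompactEmbedding κ lam N j) {f : ZFSet} (hf : f ∈ N) :
    ∃ r ∈ N, ∀ y, y ∈ r ↔ ∃ x, pair x y ∈ f := by
  have hsing : ∀ a ∈ N, ({a} : ZFSet) ∈ N := fun a ha => by simpa using h.pair_mem ha ha
  have := (h.elementary₂ (.all 4 (.ex 5 (.all 6 (.iff (.mem 6 5)
    (.ex 7 (.and (.mem 7 4) (.ex 8 (FOF.kpair 7 8 6)))))))) ∅ ∅).1 (by
    simp [FOF.Eval, FOF.eval_iff, FOF.kpair]
    intro f
    refine ⟨(⋃₀ (⋃₀ f) : ZFSet).sep fun y => ∃ x, pair x y ∈ f, fun y => ?_⟩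
    have key : ∀ p a b : ZFSet.{u}, _ ↔ p = pair a b := fun p a b =>
      kpair_iff (D := fun _ => True) (fun _ _ _ _ => trivial) (p := p) (a := a) (b := b)
        trivial trivial trivial trivial trivial
    simp only [forall_const] at key
    simp only [key, mem_sep, mem_sUnion]
    constructor
    · rintro ⟨-, x, hx⟩
      exact ⟨_, hx, x, rfl⟩
    · rintro ⟨_, hx, x, rfl⟩
      exact ⟨⟨{x, y}, ⟨_, hx, by simp [pair]⟩, by simp⟩, x, hx⟩)
  simp [FOF.Eval, FOF.eval_iff, FOF.kpair] at this
  obtain ⟨r, hr, hry⟩ := this f hf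
  have key : ∀ p a b : ZFSet.{u}, p ∈ N → a ∈ N → b ∈ N → (_ ↔ p = pair a b) :=
    fun p a b hp ha hb => kpair_iff (D := (· ∈ N)) h.trans hp ha hb (hsing a ha) (h.pair_mem ha hb)
  refine ⟨r, hr, fun y => ⟨fun hy => ?_, ?_⟩⟩
  · have hyN := h.trans _ hr _ hy
    obtain ⟨p, hp, hpf, x, hx, hpx⟩ := (hry y hyN).1 hy
    rw [key p x y hp hx hyN] at hpx
    exact ⟨x, hpx ▸ hpf⟩
  · rintro ⟨x, hx⟩
    have hp := h.trans _ hf _ hx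
    have hxy : ({x, y} : ZFSet) ∈ N := h.trans _ hp _ (by simp [pair])
    have hyN := h.trans _ hxy y (by simp)
    have hxN := h.trans _ hxy x (by simp)
    exact (hry y hyN).2 ⟨_, hp, hx, x, hxN, (key _ x y hp hxN hyN).2 rfl⟩

theorem range_mem (h : IsSupercompactEmbedding κ lam N j) (s : Set.Iio lam → ZFSet)
    (hs : ∀ a, s a ∈ N) : ZFSet.range s ∈ N := by
  let f : ZFSet := ZFSet.range fun a : Set.Iio lam => pair a.1.toZFSet (s a)
  have hf : ∀ a : Set.Iio lam, ∀ b, pair a.1.toZFSet b ∈ f ↔ b = s a := by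
    intro a b
    simp only [f, ZFSet.mem_range]
    constructor
    · rintro ⟨c, hc⟩
      obtain ⟨h1, h2⟩ := pair_injective hc
      rw [← h2, Subtype.ext (toZFSet_injective h1)]
    · rintro rfl
      exact ⟨a, rfl⟩
  have hfN : f ∈ N := by
    refine h.closed lam.toZFSet f (isOrdinal_toZFSet lam) (rank_toZFSet lam) ⟨?_, ?_⟩ ?_
    · intro p hp
      obtain ⟨a, rfl⟩ := ZFSet.mem_range.1 hp
      exact ⟨_, _, toZFSet_mem_toZFSet_iff.2 a.2, rfl⟩
    · intro a ha
      obtain ⟨b, hb, rfl⟩ := mem_toZFSet_iff.1 ha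
      exact ⟨s ⟨b, hb⟩, (hf ⟨b, hb⟩ _).2 rfl, fun y hy => (hf ⟨b, hb⟩ _).1 hy⟩
    · intro a b ha hab
      obtain ⟨c, hc, rfl⟩ := mem_toZFSet_iff.1 ha
      rw [(hf ⟨c, hc⟩ _).1 hab]
      exact hs _
  obtain ⟨r, hr, hry⟩ := h.exists_range hfN
  convert hr using 1
  ext y
  rw [hry, ZFSet.mem_range]
  constructor
  · rintro ⟨a, rfl⟩
    exact ⟨_, (hf a _).2 rfl⟩
  · rintro ⟨x, hx⟩
    obtain ⟨a, ha⟩ := ZFSet.mem_range.1 hx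
    exact ⟨a, (pair_injective ha).2⟩

theorem exists_image (h : IsSupercompactEmbedding κ lam N j) {x : ZFSet} (hx : x.Nonempty)
    (hcard : x.card ≤ lam.card) (g : ZFSet → ZFSet) (hg : ∀ y ∈ x, g y ∈ N) :
    ∃ r ∈ N, ∀ z, z ∈ r ↔ ∃ y ∈ x, z = g y := by
  have hle : Cardinal.mk x ≤ Cardinal.mk (Set.Iio lam) := by
    rw [cardinalMk_coe_sort, Cardinal.mk_Iio_ordinal]
    exact Cardinal.lift_le.2 hcard
  obtain ⟨e⟩ := hle
  obtain ⟨y₀, hy₀⟩ := hx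
  have : Nonempty x := ⟨⟨y₀, hy₀⟩⟩
  refine ⟨_, h.range_mem (fun a => g (Function.invFun e a).1) fun a => hg _ (Subtype.prop _), ?_⟩
  intro z
  rw [ZFSet.mem_range]
  constructor
  · rintro ⟨a, rfl⟩
    exact ⟨_, Subtype.prop _, rfl⟩
  · rintro ⟨y, hy, rfl⟩
    refine ⟨e ⟨y, hy⟩, ?_⟩
    rw [Function.leftInverse_invFun e.injective]

theorem mem_of_rank_lt (h : IsSupercompactEmbedding κ lam N j)
    (hcard : (V_ (κ + 1)).card ≤ lam.card) (x : ZFSet) (hx : x.rank < κ + 2) : x ∈ N := by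
  classical
  induction x using ZFSet.inductionOn with
  | _ x ih =>
    have hN : ∀ y ∈ x, y ∈ N := fun y hy => ih y hy ((rank_lt_of_mem hy).trans hx)
    have hsub : x ⊆ V_ (κ + 1) := subset_vonNeumann.2 (lt_add_two_iff.1 hx)
    rcases x.eq_empty_or_nonempty with rfl | hne
    · have : j ∅ = ∅ := by
        rw [ZFSet.eq_empty]
        have := (h.elementary₂ (.all 4 (.not (.mem 4 0))) ∅ ∅).1 (by simp [FOF.Eval])
        simp [FOF.Eval] at this
        exact fun y hy => this y (h.trans _ (h.maps _) _ hy) hy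
      exact this ▸ h.maps ∅
    · obtain ⟨r, hr, hrz⟩ := h.exists_image hne ((card_mono hsub).trans hcard) id hN
      convert hr using 1
      ext z
      simp [hrz]

theorem image_vonNeumann_isTransitive (h : IsSupercompactEmbedding κ lam N j) :
    ∀ x ∈ j (V_ κ), ∀ y ∈ x, y ∈ j (V_ κ) := by
  have := (h.elementary₂ (.all 4 (.imp (.mem 4 0) (.all 5 (.imp (.mem 5 4) (.mem 5 0)))))
    (V_ κ) (V_ κ)).1 (by
    simp [FOF.Eval, FOF.eval_imp]
    exact fun x hx y hy => (isTransitive_vonNeumann κ).mem_trans hy hx)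
  simp [FOF.Eval, FOF.eval_imp] at this
  intro x hx y hy
  have hxN := h.trans _ (h.maps _) _ hx
  exact this x hxN hx y (h.trans _ hxN _ hy) hy

theorem isPowPowEmbedding (h : IsSupercompactEmbedding κ lam N j) (hκ : κ ≤ lam) :
    IsPowPowEmbedding κ {y | y ∈ N ∧ ∀ x ∈ y, ∀ z ∈ x, z ∈ j (V_ κ)} j where
  trans := fun x ⟨hx, hxs⟩ y hy => ⟨h.trans x hx y hy, fun z hz w hw =>
    h.image_vonNeumann_isTransitive z (hxs y hy z hz) w hw⟩
  maps := fun x hx => by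
    refine ⟨h.maps x, ?_⟩
    have := (h.elementary₂ (.all 4 (.imp (.mem 4 0) (.all 5 (.imp (.mem 5 4) (.mem 5 1)))))
      x (V_ κ)).1 (by
      simp [FOF.Eval, FOF.eval_imp]
      simpa using rank_lt_add_two_iff.1 hx)
    simp [FOF.Eval, FOF.eval_imp] at this
    intro y hy z hz
    have hyN := h.trans _ (h.maps _) _ hy
    exact this y hyN hy z (h.trans _ hyN _ hz) hz
  elementary := fun φ ρ _ => by
    have := h.elementary φ.relPowPow (fun i => if i < 20 then V_ κ else ρ (i - 20))
    rw [FOF.eval_relPowPow, FOF.eval_relPowPow] at this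
    have h1 : (fun x : ZFSet => True ∧ ∀ y, True → y ∈ x → ∀ z, True → z ∈ y → z ∈ V_ κ) =
        fun x => x.rank < κ + 2 := by
      funext x
      simp only [rank_lt_add_two_iff, true_and, forall_const]
    have h2 : (fun x : ZFSet => x ∈ N ∧ ∀ y, y ∈ N → y ∈ x → ∀ z, z ∈ N → z ∈ y → z ∈ j (V_ κ)) =
        (· ∈ {y | y ∈ N ∧ ∀ x ∈ y, ∀ z ∈ x, z ∈ j (V_ κ)}) := by
      funext x
      refine eq_iff_iff.2 (and_congr_right fun hx => ⟨fun hxs y hy z hz => ?_,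
        fun hxs y _ hy z _ hz => hxs y hy z hz⟩)
      have hyN := h.trans x hx y hy
      exact hxs y hyN hy z (h.trans _ hyN _ hz) hz
    simp only [Nat.ofNat_pos, if_true, Nat.add_sub_cancel, Nat.not_lt.2 (Nat.le_add_left _ _),
      if_false] at this
    rwa [h1, h2] at this
  fix := h.fix
  crit := fun x hx hxr => ⟨(h.crit x hx hxr).1, hκ.trans_lt (h.crit x hx hxr).2⟩

end IsSupercompactEmbedding

theorem LambdaSupercompact.satB2 {κ : Ordinal.{u}}
    (h : LambdaSupercompact κ (Cardinal.beth (κ + 1)).ord) :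
    SatB2 (fun x y : PowPow κ => x.1 ∈ y.1) := by
  obtain ⟨N, j, h₁, h₂, h₃, h₄, h₅, h₆⟩ := h
  have h : IsSupercompactEmbedding κ (Cardinal.beth (κ + 1)).ord N j := ⟨h₁, h₂, h₃, h₄, h₅, h₆⟩
  have hκ : κ ≤ (Cardinal.beth (κ + 1)).ord := (Cardinal.lt_ord.2 <|
    κ.card_le_beth.trans_lt (Cardinal.beth_lt_beth.2 (Order.lt_succ κ))).le
  have hcard : (V_ (κ + 1)).card ≤ (Cardinal.beth (κ + 1)).ord.card := by
    rw [card_vonNeumann, Cardinal.card_ord]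
    exact Cardinal.preBeth_le_beth _
  have hj := h.isPowPowEmbedding hκ
  obtain ⟨U, hU, hUz⟩ := h.exists_image (x := V_ (κ + 1)) ⟨V_ κ, mem_vonNeumann.2 (by simp)⟩
    hcard j fun y _ => h.maps y
  have hVr := IsPowPowEmbedding.vonNeumann_rank_lt (κ := κ)
  refine hj.satB2 (fun x hx => ⟨h.mem_of_rank_lt hcard x hx, fun y hy z hz => ?_⟩) (U := U)
    ⟨hU, fun y hy => ?_⟩ fun z => ?_
  · have hz := rank_lt_add_two_iff.1 hx y hy z hz
    have hzr := mem_vonNeumann.1 hz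
    rwa [hj.mem_iff (lt_add_two_of_lt hzr) hVr, hj.apply_eq_self z hzr] at hz
  · obtain ⟨x, hx, rfl⟩ := (hUz y).1 hy
    have hxr : x.rank ≤ κ := Order.lt_add_one_iff.1 (mem_vonNeumann.1 hx)
    exact fun z hz => (hj.subset_iff (lt_add_two_of_le hxr) hVr).1 (subset_vonNeumann.2 hxr) hz
  · rw [hUz]
    simp only [mem_vonNeumann]

theorem TwoExtendible.satB2 {κ : Ordinal.{u}} (h : TwoExtendible κ) :
    SatB2 (fun x y : PowPow κ => x.1 ∈ y.1) := by
  obtain ⟨β, hκβ, j, h₁, h₂, h₃, h₄⟩ := h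
  simp only [Nat.cast_ofNat] at h₁ h₂
  have hj : IsPowPowEmbedding κ (Vset (β + 2)) j := by
    refine ⟨fun x hx y hy => (rank_lt_of_mem hy).trans hx, h₁, h₂, h₃, fun x hx hxr => ?_⟩
    obtain ⟨ho, hr⟩ := h₄ x hx hxr
    exact ⟨ho, hr ▸ hκβ⟩
  have hr : (V_ (κ + 1)).rank < κ + 2 := by simp
  refine hj.satB2 (fun x hx => hx.trans (lt_add_two_iff.2 ?_))
    (U := ZFSet.range fun x : V_ (κ + 1) => j x.1) ?_ fun z => ?_
  · rw [← one_add_one_eq_two, ← add_assoc]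
    exact add_le_add_left (Order.add_one_le_of_lt hκβ) 1
  · refine lt_add_two_iff.2 (rank_le_iff.2 fun y hy => ?_)
    obtain ⟨x, rfl⟩ := ZFSet.mem_range.1 hy
    have hx := (hj.mem_iff (lt_add_two_iff.2 (mem_vonNeumann.1 x.2).le) hr).1 x.2
    exact (rank_lt_of_mem hx).trans_le (lt_add_two_iff.1 (hj.maps _ hr))
  · rw [ZFSet.mem_range]
    constructor
    · rintro ⟨x, rfl⟩
      exact ⟨x.1, mem_vonNeumann.1 x.2, rfl⟩
    · rintro ⟨x, hx, rfl⟩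
      exact ⟨⟨x, mem_vonNeumann.2 hx⟩, rfl⟩

/- STATEMENT 11.  If `κ` is 2-extendible, or `κ` is `ℶ_{κ+1}`-supercompact, then
`V_{κ+2}` is a natural model of Marshall's theory `B₂`. -/
theorem statement11 (κ : Ordinal)
    (h : TwoExtendible κ ∨ LambdaSupercompact κ (Cardinal.beth (κ + 1)).ord) :
    SatB2 (fun x y : {z : ZFSet // z.rank < κ + 2} => x.1 ∈ y.1) := by
  exact h.elim TwoExtendible.satB2 LambdaSupercompact.satB2
end
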